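/- The number of subsets S of the 8×8 board with |S| = 32 such that both S and its complement are connected equals 14314228378; equivalently, the fourth gerrymander number (dissections of the 8×8 board into two connected polyominoes of area 32 each) is 7157114189. -/

import Mathlib

/-- The grid graph on the `m × n` board: two cells are adjacent when they agree
in one coordinate and differ by exactly 1 in the other. -/
def gridGraph (m n : ℕ) : SimpleGraph (Fin m × Fin n) :=
  SimpleGraph.fromRel (fun a b =>
    (a.1 = b.1 ∧ (a.2 : ℕ) + 1 = (b.2 : ℕ)) ∨ (a.2 = b.2 ∧ (a.1 : ℕ) + 1 = (b.1 : ℕ)))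

/-- A subset of cells is connected if the induced subgraph of the grid graph is
connected (in particular nonempty). -/
def ConnectedRegion (m n : ℕ) (S : Finset (Fin m × Fin n)) : Prop :=
  ((gridGraph m n).induce (S : Set (Fin m × Fin n))).Connected

namespace GM

/-! ### The data structure and the dynamic programme, written for kernel evaluation -/

/-- A dictionary from state codes to weights. -/
inductive T
  | nil
  | bst (k w : Nat) (l r : T)
  | node (d : Nat) (l r : T)

noncomputable def force (x : Nat) (f : Nat → Bool) : Bool :=
  Nat.rec (f 0) (fun n _ => f (Nat.succ n)) x

noncomputable def ins0 (k w : Nat) (t : T) (κ : T → Bool) : Bool :=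
  T.rec (motive := fun _ => (T → Bool) → Bool)
    (fun κ => κ (T.bst k w T.nil T.nil))
    (fun k' w' l r ihl ihr κ => Nat.rec
       (Nat.rec (force (Nat.add w w') (fun s => κ (T.bst k' s l r)))
          (fun _ _ => ihl (fun l' => κ (T.bst k' w' l' r))) (Nat.sub k' k))
       (fun _ _ => ihr (fun r' => κ (T.bst k' w' l r'))) (Nat.sub k k'))
    (fun d l r ihl ihr κ => Nat.rec (ihl (fun l' => κ (T.node d l' r)))
       (fun _ _ => ihr (fun r' => κ (T.node d l r'))) (Nat.land k d)) t κ

noncomputable def ins (k w : Nat) (t : T) (κ : T → Bool) : Bool :=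
  force k (fun k => ins0 k w t κ)

noncomputable def foldT (p : Nat → Nat → T → (T → Bool) → Bool) (t acc : T) (κ : T → Bool) : Bool :=
  T.rec (motive := fun _ => T → (T → Bool) → Bool) (fun acc κ => κ acc)
   (fun k w _ _ ihl ihr acc κ => p k w acc (fun a => ihl a (fun a => ihr a κ)))
   (fun _ _ _ ihl ihr acc κ => ihl acc (fun a => ihr a κ)) t acc κ

noncomputable def cut (p : Nat → Nat → T → (T → Bool) → Bool) (E : T) (n : Nat) (t : T)
    (κ : T → Bool) : Bool :=
  Nat.rec (motive := fun _ => T → (T → Bool) → Bool) (fun t κ => foldT p t E κ)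
   (fun _ ih t κ => T.rec (motive := fun _ => Bool) (foldT p t E κ)
     (fun _ _ _ _ _ _ => foldT p t E κ)
     (fun d l r _ _ => ih l (fun l' => ih r (fun r' => κ (T.node d l' r')))) t) n t κ

def E8 : T := T.nil
def E7 : T := T.node 128 E8 E8
def E6 : T := T.node 64 E7 E7
def E5 : T := T.node 32 E6 E6
def E4 : T := T.node 16 E5 E5
def E3 : T := T.node 8 E4 E4
def E2 : T := T.node 4 E3 E3
def E1 : T := T.node 2 E2 E2
def E0 : T := T.node 1 E1 E1

noncomputable def joinU (c1 e1 c e k : Nat) : Nat :=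
  Nat.lor k (Nat.mul (Nat.land (Nat.lor (Nat.shiftRight k e) (Nat.shiftRight k e1)) 65280)
    (Nat.land (Nat.lor (Nat.shiftRight k c) (Nat.shiftRight k c1)) 72340172838076673))

noncomputable def joinL (c1 e1 b1 b8 k : Nat) : Nat :=
  Nat.lor k (Nat.mul (Nat.lor (Nat.land (Nat.shiftRight k e1) 65280) b1)
    (Nat.lor (Nat.land (Nat.shiftRight k c1) 72340172838076673) b8))

noncomputable def sameZ (k : Nat) : Nat := k

noncomputable def sameF (lc jb : Nat) (J : Nat → Nat) (k : Nat) : Nat :=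
  Nat.rec (Nat.rec (J k) (fun _ _ => k) (Nat.land k lc)) (fun _ _ => k) (Nat.land k jb)

noncomputable def sameT (lc jb : Nat) (J : Nat → Nat) (k : Nat) : Nat :=
  Nat.rec (Nat.rec k (fun _ _ => J k) (Nat.land k lc)) (fun _ _ => k) (Nat.land k jb)

noncomputable def newZ (b9 k : Nat) : Nat := Nat.lor k b9

noncomputable def newF (lc b9 : Nat) (J : Nat → Nat) (k : Nat) : Nat :=
  Nat.rec (J k) (fun _ _ => Nat.lor k b9) (Nat.land k lc)

noncomputable def newT (lc b9 : Nat) (J : Nat → Nat) (k : Nat) : Nat :=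
  Nat.rec (Nat.lor k b9) (fun _ _ => J k) (Nat.land k lc)

noncomputable def mulX (w : Nat) (f : Nat → Bool) : Bool := force (Nat.mul w 36893488148044444817) f

noncomputable def close (C w : Nat) (acc : T) (κ : T → Bool) : Bool :=
  Bool.rec (Bool.rec (κ acc) (ins C w acc κ) (Nat.beq C 255)) (ins C w acc κ) (Nat.beq C 0)

noncomputable def diffI (new : Nat → Nat) (uc rx nm k w : Nat) (acc : T) (κ : T → Bool) : Bool :=
  Nat.rec (force (Nat.xor (Nat.land k 255) uc) fun C => close C w acc κ)
   (fun _ _ => force (Nat.xor (Nat.land k nm) uc) fun k => ins (new k) w acc κ)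
   (Nat.land k rx)

noncomputable def procS (sF sT nF nT : Nat → Nat) (uc rx nm k w : Nat) (acc : T)
    (κ : T → Bool) : Bool :=
  Nat.rec (ins (sF k) w acc fun acc => mulX w fun w => diffI nT uc rx nm k w acc κ)
    (fun _ _ => diffI nF uc rx nm k w acc fun acc => mulX w fun w => ins (sT k) w acc κ)
    (Nat.land k uc)

noncomputable def procF (nF nT : Nat → Nat) (uc k w : Nat) (acc : T) (κ : T → Bool) : Bool :=
  ins (nF k) w acc fun acc => mulX w fun w => force (Nat.lor k uc) fun k => ins (nT k) w acc κ

/-- Row `i` of the connectivity matrix. -/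
def row (k i : Nat) : Nat := Nat.land (Nat.shiftRight k (Nat.add 8 (Nat.mul 8 i))) 255

/-- The final acceptance test. -/
def accB (k : Nat) : Bool :=
  Nat.beq (Nat.shiftRight k 8) 0 ||
    (Nat.beq (row k (Nat.log2 (Nat.land k 255))) (Nat.land k 255) &&
      Nat.beq (row k (Nat.log2 (Nat.sub 255 (Nat.land k 255)))) (Nat.sub 255 (Nat.land k 255)))

noncomputable def fin (t : T) (a : Nat) (f : Nat → Bool) : Bool :=
  T.rec (motive := fun _ => Nat → (Nat → Bool) → Bool) (fun a f => f a)
   (fun k w _ _ ihl ihr a f => Bool.rec (ihl a (fun a => ihr a f))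
      (force (Nat.add w a) (fun a => ihl a (fun a => ihr a f))) (accB k))
   (fun _ _ _ ihl ihr a f => ihl a (fun a => ihr a f)) t a f

noncomputable def rowF (t : T) (κ : T → Bool) : Bool :=
  cut (procF (newZ 256) (newZ 256) 1) E0 0 t fun t =>
  cut (procF (newF 1 131072 (joinL 8 0 512 256))
      (newT 1 131072 (joinL 8 0 512 256)) 2) E1 1 t fun t =>
  cut (procF (newF 2 67108864 (joinL 9 8 1024 65536))
      (newT 2 67108864 (joinL 9 8 1024 65536)) 4) E2 2 t fun t =>
  cut (procF (newF 4 34359738368 (joinL 10 16 2048 16777216))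
      (newT 4 34359738368 (joinL 10 16 2048 16777216)) 8) E3 3 t fun t =>
  cut (procF (newF 8 17592186044416 (joinL 11 24 4096 4294967296))
      (newT 8 17592186044416 (joinL 11 24 4096 4294967296)) 16) E4 4 t fun t =>
  cut (procF (newF 16 9007199254740992 (joinL 12 32 8192 1099511627776))
      (newT 16 9007199254740992 (joinL 12 32 8192 1099511627776)) 32) E5 5 t fun t =>
  cut (procF (newF 32 4611686018427387904 (joinL 13 40 16384 281474976710656))
      (newT 32 4611686018427387904 (joinL 13 40 16384 281474976710656)) 64) E6 6 t fun t =>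
  cut (procF (newF 64 2361183241434822606848 (joinL 14 48 32768 72057594037927936))
      (newT 64 2361183241434822606848 (joinL 14 48 32768 72057594037927936)) 128) E7 7 t fun t =>
  κ t

noncomputable def rowS (t : T) (κ : T → Bool) : Bool :=
  cut (procS sameZ sameZ
      (newZ 256) (newZ 256)
      1 65024 4703847398623097520383) E0 0 t fun t =>
  cut (procS (sameF 1 65536 (joinU 8 0 9 8))
      (sameT 1 65536 (joinU 8 0 9 8))
      (newF 1 131072 (joinL 8 0 512 256))
      (newT 1 131072 (joinL 8 0 512 256))
      2 16580608 4685328314376533376511) E1 1 t fun t =>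
  cut (procS (sameF 2 33554432 (joinU 9 8 10 16))
      (sameT 2 33554432 (joinU 9 8 10 16))
      (newF 2 67108864 (joinL 9 8 1024 65536))
      (newT 2 67108864 (joinL 9 8 1024 65536))
      4 4211081216 4648290145879243619327) E2 2 t fun t =>
  cut (procS (sameF 4 17179869184 (joinU 10 16 11 24))
      (sameT 4 17179869184 (joinU 10 16 11 24))
      (newF 4 34359738368 (joinL 10 16 2048 16777216))
      (newT 4 34359738368 (joinL 10 16 2048 16777216))
      8 1060856922112 4574213807836407265279) E3 3 t fun t =>
  cut (procS (sameF 8 8796093022208 (joinU 11 24 12 32))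
      (sameT 8 8796093022208 (joinU 11 24 12 32))
      (newF 8 17592186044416 (joinL 11 24 4096 4294967296))
      (newT 8 17592186044416 (joinL 11 24 4096 4294967296))
      16 262783279038464 4426060872141604122623) E4 4 t fun t =>
  cut (procS (sameF 16 4503599627370496 (joinU 12 32 13 40))
      (sameT 16 4503599627370496 (joinU 12 32 13 40))
      (newF 16 9007199254740992 (joinL 12 32 8192 1099511627776))
      (newT 16 9007199254740992 (joinL 12 32 8192 1099511627776))
      32 62768919806476288 4129693018060314632191) E5 5 t fun t =>
  cut (procS (sameF 32 2305843009213693952 (joinU 13 40 14 48))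
      (sameT 32 2305843009213693952 (joinU 13 40 14 48))
      (newF 32 4611686018427387904 (joinL 13 40 16384 281474976710656))
      (newT 32 4611686018427387904 (joinL 13 40 16384 281474976710656))
      64 13763000461244235776 3523382090629352767487) E6 6 t fun t =>
  cut (procS (sameF 64 1180591620717411303424 (joinU 14 48 15 56))
      (sameT 64 1180591620717411303424 (joinU 14 48 15 56))
      (newF 64 2361183241434822606848 (joinL 14 48 32768 72057594037927936))
      (newT 64 2361183241434822606848 (joinL 14 48 32768 72057594037927936))
      128 2342736497361113055232 9187201950435737599) E7 7 t fun t =>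
  κ t

noncomputable def main : Bool :=
  rowF (T.bst 0 1 T.nil T.nil) fun t =>
  rowS t fun t =>
  rowS t fun t =>
  rowS t fun t =>
  rowS t fun t =>
  rowS t fun t =>
  rowS t fun t =>
  rowS t fun t =>
  fin t 0 (fun a => Nat.beq (Nat.mod (Nat.div a (Nat.pow 36893488148044444817 32)) 36893488148044444817) 14314228378)

theorem main_true : main = true := by decide +kernel


end GM

namespace GM

/-! ### Semantics of the data structure -/

/-- Weighted evaluation of a dictionary. -/
def ev (g : ℕ → ℕ) : T → ℕ
  | .nil => 0
  | .bst k w l r => w * g k + ev g l + ev g r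
  | .node _ l r => ev g l + ev g r

/-- The weight variable (a large radix). -/
def X : ℕ := 36893488148044444817

theorem force_eq (x : ℕ) (f : ℕ → Bool) : force x f = f x := by
  cases x <;> rfl

theorem ins0_spec (k w : ℕ) (t : T) :
    ∃ t', (∀ κ, ins0 k w t κ = κ t') ∧ ∀ g, ev g t' = w * g k + ev g t := by
  induction t with
  | nil => exact ⟨_, fun κ => rfl, fun g => by simp [ev]⟩
  | bst k' w' l r ihl ihr =>
    obtain ⟨l', hl, hl'⟩ := ihl
    obtain ⟨r', hr, hr'⟩ := ihr
    rcases h1 : k - k' with _ | n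
    · rcases h2 : k' - k with _ | m
      · have : k = k' := by omega
        subst this
        refine ⟨T.bst k (w + w') l r, fun κ => ?_, fun g => by simp [ev]; ring⟩
        unfold ins0
        dsimp only
        have e : Nat.sub k k = 0 := Nat.sub_self k
        rw [e]
        exact force_eq _ _
      · refine ⟨T.bst k' w' l' r, fun κ => ?_, fun g => by simp [ev, hl']; ring⟩
        unfold ins0
        dsimp only
        have e : Nat.sub k k' = 0 := h1
        have e2 : Nat.sub k' k = m + 1 := h2
        rw [e, e2]
        exact hl _
    · refine ⟨T.bst k' w' l r', fun κ => ?_, fun g => by simp [ev, hr']; ring⟩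
      unfold ins0
      dsimp only
      have e : Nat.sub k k' = n + 1 := h1
      rw [e]
      exact hr _
  | node d l r ihl ihr =>
    obtain ⟨l', hl, hl'⟩ := ihl
    obtain ⟨r', hr, hr'⟩ := ihr
    rcases h1 : Nat.land k d with _ | n
    · refine ⟨T.node d l' r, fun κ => ?_, fun g => by simp [ev, hl']; ring⟩
      unfold ins0
      dsimp only
      rw [h1]
      exact hl _
    · refine ⟨T.node d l r', fun κ => ?_, fun g => by simp [ev, hr']; ring⟩
      unfold ins0
      dsimp only
      rw [h1]
      exact hr _

theorem ins_spec (k w : ℕ) (t : T) :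
    ∃ t', (∀ κ, ins k w t κ = κ t') ∧ ∀ g, ev g t' = w * g k + ev g t := by
  obtain ⟨t', h, h'⟩ := ins0_spec k w t
  exact ⟨t', fun κ => by rw [ins, force_eq, h], h'⟩

/-- Evaluation at an optional state. -/
def opt (g : ℕ → ℕ) (o : Option ℕ) : ℕ := o.elim 0 g

/-- Specification of a state-processing procedure. -/
def ProcSpec (p : ℕ → ℕ → T → (T → Bool) → Bool) (s : Bool → ℕ → Option ℕ) : Prop :=
  ∀ k w acc, ∃ acc', (∀ κ, p k w acc κ = κ acc') ∧
    ∀ g, ev g acc' = ev g acc + w * (opt g (s false k) + X * opt g (s true k))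

/-- The transferred test function. -/
def tr (s : Bool → ℕ → Option ℕ) (g : ℕ → ℕ) (k : ℕ) : ℕ :=
  opt g (s false k) + X * opt g (s true k)

theorem foldT_spec {p s} (hp : ProcSpec p s) (t : T) : ∀ acc, 
    ∃ t', (∀ κ, foldT p t acc κ = κ t') ∧ ∀ g, ev g t' = ev g acc + ev (tr s g) t := by
  induction t with
  | nil => exact fun acc => ⟨acc, fun κ => rfl, fun g => by simp [ev]⟩
  | bst k w l r ihl ihr =>
    intro acc
    obtain ⟨a1, h1, h1'⟩ := hp k w acc
    obtain ⟨a2, h2, h2'⟩ := ihl a1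
    obtain ⟨a3, h3, h3'⟩ := ihr a2
    refine ⟨a3, fun κ => ?_, fun g => ?_⟩
    · exact (h1 _).trans ((h2 _).trans (h3 _))
    · rw [h3', h2', h1', ev, tr]; ring
  | node d l r ihl ihr =>
    intro acc
    obtain ⟨a2, h2, h2'⟩ := ihl acc
    obtain ⟨a3, h3, h3'⟩ := ihr a2
    refine ⟨a3, fun κ => ?_, fun g => ?_⟩
    · exact ((h2 _).trans (h3 _))
    · rw [h3', h2', ev]; ring

theorem cut_spec {p s} (hp : ProcSpec p s) (E : T) (hE : ∀ g, ev g E = 0) (n : ℕ) : ∀ t : T, 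
    ∃ t', (∀ κ, cut p E n t κ = κ t') ∧ ∀ g, ev g t' = ev (tr s g) t := by
  have base : ∀ t : T, ∃ t', (∀ κ, foldT p t E κ = κ t') ∧ ∀ g, ev g t' = ev (tr s g) t := by
    intro t
    obtain ⟨t', h, h'⟩ := foldT_spec hp t E
    exact ⟨t', h, fun g => by rw [h', hE, zero_add]⟩
  induction n with
  | zero => exact base
  | succ n ih =>
    intro t
    cases t with
    | nil => exact base T.nil
    | bst k w l r => exact base (T.bst k w l r)
    | node d l r =>
      obtain ⟨a2, h2, h2'⟩ := ih l
      obtain ⟨a3, h3, h3'⟩ := ih r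
      exact ⟨T.node d a2 a3, fun κ => (h2 _).trans (h3 _), fun g => by simp [ev, h2', h3']⟩

theorem fin_spec (t : T) : ∀ a f, fin t a f = f (a + ev (fun k => if accB k then 1 else 0) t) := by
  induction t with
  | nil => exact fun a f => rfl
  | bst k w l r ihl ihr =>
    intro a f
    rcases h : accB k with _ | _
    · have : fin (T.bst k w l r) a f = fin l a (fun a => fin r a f) := by
        unfold fin
        dsimp only
        rw [h]
      rw [this, ihl, ihr, ev, h]
      simp [add_assoc]
    · have : fin (T.bst k w l r) a f = force (Nat.add w a) (fun a => fin l a (fun a => fin r a f)) := by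
        unfold fin
        dsimp only
        rw [h]
      rw [this, force_eq, ihl, ihr, ev, h]
      congr 1
      simp
      ring
  | node d l r ihl ihr =>
    intro a f
    have : fin (T.node d l r) a f = fin l a (fun a => fin r a f) := rfl
    rw [this, ihl, ihr, ev, add_assoc]

/-! ### The transition function -/

noncomputable def sF : ℕ → ℕ → ℕ
  | 0 => sameZ
  | c + 1 => sameF (2 ^ c) (2 ^ (9 * c + 16)) (joinU (c + 8) (8 * c) (c + 9) (8 * c + 8))

noncomputable def sT : ℕ → ℕ → ℕ
  | 0 => sameZ
  | c + 1 => sameT (2 ^ c) (2 ^ (9 * c + 16)) (joinU (c + 8) (8 * c) (c + 9) (8 * c + 8))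

noncomputable def nF : ℕ → ℕ → ℕ
  | 0 => newZ 256
  | c + 1 => newF (2 ^ c) (2 ^ (9 * c + 17)) (joinL (c + 8) (8 * c) (2 ^ (c + 9)) (2 ^ (8 * c + 8)))

noncomputable def nT : ℕ → ℕ → ℕ
  | 0 => newZ 256
  | c + 1 => newT (2 ^ c) (2 ^ (9 * c + 17)) (joinL (c + 8) (8 * c) (2 ^ (c + 9)) (2 ^ (8 * c + 8)))

/-- Mask of the off-diagonal entries of row `c`. -/
def rxc (c : ℕ) : ℕ := (255 * 2 ^ (8 * c) - 2 ^ (9 * c)) * 2 ^ 8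

/-- Mask erasing row and column `c`. -/
def nmc : ℕ → ℕ
  | 0 => 4703847398623097520383
  | 1 => 4685328314376533376511
  | 2 => 4648290145879243619327
  | 3 => 4574213807836407265279
  | 4 => 4426060872141604122623
  | 5 => 4129693018060314632191
  | 6 => 3523382090629352767487
  | _ => 9187201950435737599

noncomputable def sm (K : Bool) (c k : ℕ) : ℕ := if K then sT c k else sF c k
noncomputable def nw (K : Bool) (c k : ℕ) : ℕ := if K then nT c k else nF c k

/-- First-row transition. -/
noncomputable def stepF (c : ℕ) (K : Bool) (k : ℕ) : Option ℕ :=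
  some (nw K c (if K then k ||| 2 ^ c else k))

/-- Transition when the new colour differs from the colour above. -/
noncomputable def stepD (c : ℕ) (K : Bool) (k : ℕ) : Option ℕ :=
  if k &&& rxc c = 0 then
    (if (k &&& 255) ^^^ 2 ^ c = 0 ∨ (k &&& 255) ^^^ 2 ^ c = 255 then
      some ((k &&& 255) ^^^ 2 ^ c) else none)
  else some (nw K c ((k &&& nmc c) ^^^ 2 ^ c))

/-- Transition for later rows. -/
noncomputable def stepS (c : ℕ) (K : Bool) (k : ℕ) : Option ℕ :=
  if k.testBit c = K then some (sm K c k) else stepD c K k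

theorem procF_spec (c : ℕ) : ProcSpec (procF (nF c) (nT c) (2 ^ c)) (stepF c) := by
  intro k w acc
  obtain ⟨a1, h1, h1'⟩ := ins_spec (nF c k) w acc
  obtain ⟨a2, h2, h2'⟩ := ins_spec (nT c (k ||| 2 ^ c)) (w * X) a1
  refine ⟨a2, fun κ => ?_, fun g => ?_⟩
  · unfold procF mulX
    rw [h1, force_eq, force_eq]
    exact h2 _
  · rw [h2', h1']
    simp [stepF, opt, nw]
    ring

theorem close_spec (C w : ℕ) (acc : T) : ∃ acc', (∀ κ, close C w acc κ = κ acc') ∧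
    ∀ g, ev g acc' = ev g acc + w * opt g (if C = 0 ∨ C = 255 then some C else none) := by
  obtain ⟨a1, h1, h1'⟩ := ins_spec C w acc
  unfold close
  rcases e0 : Nat.beq C 0 with _ | _
  · rcases e1 : Nat.beq C 255 with _ | _
    · have n0 := Nat.ne_of_beq_eq_false e0
      have n1 := Nat.ne_of_beq_eq_false e1
      exact ⟨acc, fun κ => rfl, fun g => by simp [n0, n1, opt]⟩
    · have := Nat.eq_of_beq_eq_true e1
      exact ⟨a1, h1, fun g => by rw [h1']; simp [this, opt]; ring⟩
  · have := Nat.eq_of_beq_eq_true e0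
    exact ⟨a1, h1, fun g => by rw [h1']; simp [this, opt]; ring⟩

theorem diffI_spec (new : ℕ → ℕ) (c : ℕ) (K : Bool) (hn : ∀ k, new k = nw K c k) (k w : ℕ)
    (acc : T) :
    ∃ acc', (∀ κ, diffI new (2 ^ c) (rxc c) (nmc c) k w acc κ = κ acc') ∧
    ∀ g, ev g acc' = ev g acc + w * opt g (stepD c K k) := by
  unfold diffI
  rcases e : Nat.land k (rxc c) with _ | n
  · have e' : k &&& rxc c = 0 := e
    obtain ⟨a1, h1, h1'⟩ := close_spec ((k &&& 255) ^^^ 2 ^ c) w acc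
    refine ⟨a1, fun κ => (force_eq _ _).trans (h1 κ), fun g => ?_⟩
    rw [h1', stepD, if_pos e']
  · have e' : k &&& rxc c ≠ 0 := fun h => by
      have : Nat.land k (rxc c) = 0 := h
      omega
    obtain ⟨a1, h1, h1'⟩ := ins_spec (new ((k &&& nmc c) ^^^ 2 ^ c)) w acc
    refine ⟨a1, fun κ => (force_eq _ _).trans (h1 κ), fun g => ?_⟩
    rw [h1', stepD, if_neg e', hn]
    simp [opt]
    ring

theorem land_two_pow_zero {k c : ℕ} (h : Nat.land k (2 ^ c) = 0) : k.testBit c = false := by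
  have h' : k &&& 2 ^ c = 0 := h
  rw [Nat.and_two_pow] at h'
  cases hb : k.testBit c <;> simp_all

theorem land_two_pow_succ {k c n : ℕ} (h : Nat.land k (2 ^ c) = n + 1) : k.testBit c = true := by
  have h' : k &&& 2 ^ c = n + 1 := h
  rw [Nat.and_two_pow] at h'
  cases hb : k.testBit c <;> simp_all

theorem procS_spec (c : ℕ) :
    ProcSpec (procS (sF c) (sT c) (nF c) (nT c) (2 ^ c) (rxc c) (nmc c)) (stepS c) := by
  intro k w acc
  unfold procS mulX
  rcases e : Nat.land k (2 ^ c) with _ | n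
  · have hb := land_two_pow_zero e
    obtain ⟨a1, h1, h1'⟩ := ins_spec (sF c k) w acc
    obtain ⟨a2, h2, h2'⟩ := diffI_spec (nT c) c true (fun k => by simp [nw]) k (w * X) a1
    refine ⟨a2, fun κ => (h1 _).trans ((force_eq _ _).trans (h2 _)), fun g => ?_⟩
    rw [h2', h1']
    simp [stepS, hb, sm, opt]
    ring
  · have hb := land_two_pow_succ e
    obtain ⟨a1, h1, h1'⟩ := diffI_spec (nF c) c false (fun k => by simp [nw]) k w acc
    obtain ⟨a2, h2, h2'⟩ := ins_spec (sT c k) (w * X) a1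
    refine ⟨a2, fun κ => (h1 _).trans ((force_eq _ _).trans (h2 _)), fun g => ?_⟩
    rw [h2', h1']
    simp [stepS, hb, sm, opt]
    ring

/-- One step of the automaton: the cell with index `t` gets colour `K`. -/
noncomputable def step (t : ℕ) (K : Bool) (k : ℕ) : Option ℕ :=
  if t < 16 then stepF (t % 8) K k else stepS (t % 8) K k

/-- The state of the automaton before reading cell `t`. -/
noncomputable def st (F : Finset ℕ) : ℕ → Option ℕ
  | 0 => some 0
  | t + 1 => if t < 8 then some 0 else (st F t).bind (step t (decide (t ∈ F)))

theorem st_succ (F : Finset ℕ) {t : ℕ} (h : 8 ≤ t) :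
    st F (t + 1) = (st F t).bind (step t (decide (t ∈ F))) := by
  rw [st, if_neg (by omega)]

theorem st_eight (F : Finset ℕ) : st F 8 = some 0 := by
  rw [st, if_pos (by omega)]

theorem st_insert (F : Finset ℕ) (n t : ℕ) (h : t ≤ n) : st (insert n F) t = st F t := by
  induction t with
  | zero => rfl
  | succ t ih =>
    rw [st, st, ih (by omega)]
    have : (t ∈ insert n F) ↔ t ∈ F := by
      rw [Finset.mem_insert]
      constructor
      · rintro (h | h)
        · omega
        · exact h
      · exact Or.inr
    simp [this]

/-- The invariant of the dynamic programme. -/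
def Lev (t : ℕ) (D : T) : Prop :=
  ∀ g, ev g D = ∑ F ∈ (Finset.Ico 8 t).powerset, X ^ F.card * opt g (st F t)

theorem opt_tr (s : Bool → ℕ → Option ℕ) (g : ℕ → ℕ) (o : Option ℕ) :
    opt (tr s g) o = opt g (o.bind (s false)) + X * opt g (o.bind (s true)) := by
  cases o <;> simp [opt, tr]

theorem Lev_succ {t : ℕ} (ht : 8 ≤ t) {D D' : T} (h : Lev t D)
    (h' : ∀ g, ev g D' = ev (tr (step t) g) D) : Lev (t + 1) D' := by
  intro g
  rw [h', h, ← Finset.insert_Ico_right_eq_Ico_add_one ht, Finset.sum_powerset_insert (by simp),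
    ← Finset.sum_add_distrib]
  refine Finset.sum_congr rfl fun F hF => ?_
  have hF' : t ∉ F := fun h => by
    have := Finset.mem_powerset.1 hF h
    simp at this
  rw [st_succ _ ht, st_succ _ ht, st_insert _ _ _ le_rfl, Finset.card_insert_of_notMem hF', opt_tr]
  simp [hF', pow_succ]
  ring

end GM

namespace GM

theorem ev_E (g : ℕ → ℕ) : ev g E0 = 0 ∧ ev g E1 = 0 ∧ ev g E2 = 0 ∧ ev g E3 = 0 ∧ ev g E4 = 0 ∧
    ev g E5 = 0 ∧ ev g E6 = 0 ∧ ev g E7 = 0 := by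
  simp [E0, E1, E2, E3, E4, E5, E6, E7, E8, ev]

theorem cutF (c : ℕ) (hc : c < 8) (n : ℕ) (E : T) (hE : ∀ g, ev g E = 0) {D : T}
    (h : Lev (8 + c) D) :
    ∃ D', (∀ κ, cut (procF (nF c) (nT c) (2 ^ c)) E n D κ = κ D') ∧ Lev (8 + c + 1) D' := by
  obtain ⟨D', h1, h2⟩ := cut_spec (procF_spec c) E hE n D
  refine ⟨D', h1, Lev_succ (by omega) h fun g => ?_⟩
  have : step (8 + c) = stepF c := by
    funext K k
    rw [step, if_pos (by omega), show (8 + c) % 8 = c by omega]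
  rw [this, h2]

theorem cutS (r : ℕ) (c : ℕ) (hc : c < 8) (n : ℕ) (E : T) (hE : ∀ g, ev g E = 0) {D : T}
    (h : Lev (8 * r + 16 + c) D) :
    ∃ D', (∀ κ, cut (procS (sF c) (sT c) (nF c) (nT c) (2 ^ c) (rxc c) (nmc c)) E n D κ = κ D') ∧
      Lev (8 * r + 16 + c + 1) D' := by
  obtain ⟨D', h1, h2⟩ := cut_spec (procS_spec c) E hE n D
  refine ⟨D', h1, Lev_succ (by omega) h fun g => ?_⟩
  have : step (8 * r + 16 + c) = stepS c := by
    funext K k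
    rw [step, if_neg (by omega), show (8 * r + 16 + c) % 8 = c by omega]
  rw [this, h2]

theorem rowF_spec {D : T} (h : Lev 8 D) : ∃ D', (∀ κ, rowF D κ = κ D') ∧ Lev 16 D' := by
  obtain ⟨D0, e0, h⟩ := cutF 0 (by omega) 0 E0 (fun g => (ev_E g).1) h
  obtain ⟨D1, e1, h⟩ := cutF 1 (by omega) 1 E1 (fun g => (ev_E g).2.1) h
  obtain ⟨D2, e2, h⟩ := cutF 2 (by omega) 2 E2 (fun g => (ev_E g).2.2.1) h
  obtain ⟨D3, e3, h⟩ := cutF 3 (by omega) 3 E3 (fun g => (ev_E g).2.2.2.1) h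
  obtain ⟨D4, e4, h⟩ := cutF 4 (by omega) 4 E4 (fun g => (ev_E g).2.2.2.2.1) h
  obtain ⟨D5, e5, h⟩ := cutF 5 (by omega) 5 E5 (fun g => (ev_E g).2.2.2.2.2.1) h
  obtain ⟨D6, e6, h⟩ := cutF 6 (by omega) 6 E6 (fun g => (ev_E g).2.2.2.2.2.2.1) h
  obtain ⟨D7, e7, h⟩ := cutF 7 (by omega) 7 E7 (fun g => (ev_E g).2.2.2.2.2.2.2) h
  refine ⟨D7, fun κ => ?_, h⟩
  exact (e0 _).trans <| (e1 _).trans <| (e2 _).trans <| (e3 _).trans <| (e4 _).trans <|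
    (e5 _).trans <| (e6 _).trans <| (e7 _)

theorem rowS_spec (r : ℕ) {D : T} (h : Lev (8 * r + 16) D) :
    ∃ D', (∀ κ, rowS D κ = κ D') ∧ Lev (8 * r + 24) D' := by
  obtain ⟨D0, e0, h⟩ := cutS r 0 (by omega) 0 E0 (fun g => (ev_E g).1) h
  obtain ⟨D1, e1, h⟩ := cutS r 1 (by omega) 1 E1 (fun g => (ev_E g).2.1) h
  obtain ⟨D2, e2, h⟩ := cutS r 2 (by omega) 2 E2 (fun g => (ev_E g).2.2.1) h
  obtain ⟨D3, e3, h⟩ := cutS r 3 (by omega) 3 E3 (fun g => (ev_E g).2.2.2.1) h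
  obtain ⟨D4, e4, h⟩ := cutS r 4 (by omega) 4 E4 (fun g => (ev_E g).2.2.2.2.1) h
  obtain ⟨D5, e5, h⟩ := cutS r 5 (by omega) 5 E5 (fun g => (ev_E g).2.2.2.2.2.1) h
  obtain ⟨D6, e6, h⟩ := cutS r 6 (by omega) 6 E6 (fun g => (ev_E g).2.2.2.2.2.2.1) h
  obtain ⟨D7, e7, h⟩ := cutS r 7 (by omega) 7 E7 (fun g => (ev_E g).2.2.2.2.2.2.2) h
  refine ⟨D7, fun κ => ?_, h⟩
  exact (e0 _).trans <| (e1 _).trans <| (e2 _).trans <| (e3 _).trans <| (e4 _).trans <|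
    (e5 _).trans <| (e6 _).trans <| (e7 _)

/-- The generating function of accepted colourings. -/
noncomputable def total : ℕ :=
  ∑ F ∈ (Finset.Ico 8 72).powerset, X ^ F.card * opt (fun k => if accB k then 1 else 0) (st F 72)

theorem beq_aux (a n : ℕ) (h : Nat.beq (Nat.mod (Nat.div a (Nat.pow 36893488148044444817 32))
    36893488148044444817) n = true) : a / X ^ 32 % X = n :=
  Nat.eq_of_beq_eq_true h

/-- The final comparison. -/
def chk (a : ℕ) : Bool :=
  Nat.beq (Nat.mod (Nat.div a (Nat.pow 36893488148044444817 32)) 36893488148044444817) 14314228378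

theorem chk_aux (a : ℕ) (h : chk a = true) : a / X ^ 32 % X = 14314228378 :=
  beq_aux a _ h

theorem main_spec : ∃ a, a = total ∧ main = chk a := by
  have h : Lev 8 (T.bst 0 1 T.nil T.nil) := by
    intro g
    simp [ev, st_eight, opt]
  obtain ⟨D0, e0, h⟩ := rowF_spec h
  obtain ⟨D1, e1, h⟩ := rowS_spec 0 h
  obtain ⟨D2, e2, h⟩ := rowS_spec 1 h
  obtain ⟨D3, e3, h⟩ := rowS_spec 2 h
  obtain ⟨D4, e4, h⟩ := rowS_spec 3 h
  obtain ⟨D5, e5, h⟩ := rowS_spec 4 h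
  obtain ⟨D6, e6, h⟩ := rowS_spec 5 h
  obtain ⟨D7, e7, h⟩ := rowS_spec 6 h
  refine ⟨0 + ev (fun k => if accB k then 1 else 0) D7, (Nat.zero_add _).trans (h _), ?_⟩
  have e8 : fin D7 0 chk = chk (0 + ev (fun k => if accB k then 1 else 0) D7) := fin_spec _ _ _
  exact (e0 _).trans <| (e1 _).trans <| (e2 _).trans <| (e3 _).trans <| (e4 _).trans <|
    (e5 _).trans <| (e6 _).trans <| (e7 _).trans e8

theorem total_spec : total / X ^ 32 % X = 14314228378 := by
  obtain ⟨a, ha, hm⟩ := main_spec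
  rw [← ha]
  exact chk_aux a (hm.symm.trans main_true)

end GM

namespace GM

/-! ### Bit-level description of the transition functions -/

theorem outer0 (r : ℕ) (hr : r < 2 ^ 8) (i : ℕ) : ∀ (cc j : ℕ), j < 8 →
    (∀ m, cc.testBit m = true → m % 8 = 0) →
    (r * cc).testBit (8 * i + j) = (cc.testBit (8 * i) && r.testBit j) := by
  have key : ∀ cc : ℕ, (∀ m, cc.testBit m = true → m % 8 = 0) →
      cc = 2 ^ 8 * (cc >>> 8) + (cc.testBit 0).toNat := by
    intro cc h
    apply Nat.eq_of_testBit_eq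
    intro m
    have hb : (cc.testBit 0).toNat < 2 ^ 8 := by
      cases cc.testBit 0 <;> decide
    rw [Nat.testBit_two_pow_mul_add _ hb]
    split_ifs with h1
    · by_cases h0 : m = 0
      · subst h0
        cases cc.testBit 0 <;> decide
      · have : cc.testBit m = false := by
          by_contra hh
          have := h m (by simpa using hh)
          omega
        rw [this]
        have h2 : (cc.testBit 0).toNat < 2 ^ m := by
          have : 2 ^ 1 ≤ 2 ^ m := Nat.pow_le_pow_right (by omega) (by omega)
          have := Bool.toNat_lt (cc.testBit 0)
          omega
        rw [Nat.testBit_lt_two_pow h2]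
    · rw [Nat.testBit_shiftRight]
      congr 1
      omega
  induction i with
  | zero =>
    intro cc j hj h
    have e := key cc h
    have : r * cc = 2 ^ 8 * (r * (cc >>> 8)) + r * (cc.testBit 0).toNat := by
      conv_lhs => rw [e]
      ring
    rw [this]
    rw [Nat.testBit_two_pow_mul_add]
    · rw [if_pos (by omega)]
      cases cc.testBit 0 <;> simp
    · cases cc.testBit 0 <;> simp <;> omega
  | succ i ih =>
    intro cc j hj h
    have e := key cc h
    have : r * cc = 2 ^ 8 * (r * (cc >>> 8)) + r * (cc.testBit 0).toNat := by
      conv_lhs => rw [e]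
      ring
    rw [this]
    rw [Nat.testBit_two_pow_mul_add]
    · rw [if_neg (by omega), show 8 * (i + 1) + j - 8 = 8 * i + j by omega, ih _ j hj,
        Nat.testBit_shiftRight]
      · congr 2
        ring
      · intro m hm
        rw [Nat.testBit_shiftRight] at hm
        have := h _ hm
        omega
    · cases cc.testBit 0 <;> simp <;> omega

theorem outer (r cc : ℕ) (hr : ∀ m, r.testBit m = true → 8 ≤ m ∧ m < 16)
    (hc : ∀ m, cc.testBit m = true → m % 8 = 0) (i j : ℕ) (hj : j < 8) :
    (r * cc).testBit (8 + 8 * i + j) = (cc.testBit (8 * i) && r.testBit (8 + j)) := by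
  have e : r = 2 ^ 8 * (r >>> 8) := by
    apply Nat.eq_of_testBit_eq
    intro m
    rw [Nat.testBit_two_pow_mul, Nat.testBit_shiftRight]
    by_cases h : 8 ≤ m
    · simp [h]
    · simp only [h, decide_false, Bool.false_and]
      by_contra hh
      exact h (hr m (by simpa using hh)).1
  have h8 : r >>> 8 < 2 ^ 8 := by
    apply Nat.lt_pow_two_of_testBit
    intro m hm
    rw [Nat.testBit_shiftRight]
    by_contra hh
    have := (hr (8 + m) (by simpa using hh)).2
    omega
  have e2 : r * cc = 2 ^ 8 * ((r >>> 8) * cc) := by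
    conv_lhs => rw [e]
    ring
  rw [e2, Nat.testBit_two_pow_mul, show 8 + 8 * i + j - 8 = 8 * i + j by omega,
    outer0 _ h8 _ _ _ hj hc, Nat.testBit_shiftRight]
  simp [add_assoc]

theorem outer_lt (r cc : ℕ) (hr : ∀ m, r.testBit m = true → 8 ≤ m ∧ m < 16) (m : ℕ) (hm : m < 8) :
    (r * cc).testBit m = false := by
  have e : r = 2 ^ 8 * (r >>> 8) := by
    apply Nat.eq_of_testBit_eq
    intro m
    rw [Nat.testBit_two_pow_mul, Nat.testBit_shiftRight]
    by_cases h : 8 ≤ m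
    · simp [h]
    · simp only [h, decide_false, Bool.false_and]
      by_contra hh
      exact h (hr m (by simpa using hh)).1
  rw [e, mul_assoc, Nat.testBit_two_pow_mul]
  simp
  omega

theorem tb_M (m : ℕ) : (72340172838076673).testBit m = (decide (m % 8 = 0) && decide (m < 64)) := by
  by_cases h : m < 64
  · revert m
    decide
  · rw [Nat.testBit_lt_two_pow]
    · simp [h]
    · calc 72340172838076673 < 2 ^ 64 := by norm_num
        _ ≤ 2 ^ m := Nat.pow_le_pow_right (by omega) (by omega)

theorem tb_R (m : ℕ) : (65280).testBit m = (decide (8 ≤ m) && decide (m < 16)) := by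
  by_cases h : m < 16
  · revert m
    decide
  · rw [Nat.testBit_lt_two_pow]
    · simp [h]
    · calc 65280 < 2 ^ 16 := by norm_num
        _ ≤ 2 ^ m := Nat.pow_le_pow_right (by omega) (by omega)

/-- Connectivity bits of a state. -/
def B (k i j : ℕ) : Bool := k.testBit (8 + 8 * i + j)

theorem joinU_B (c k i j : ℕ) (hi : i < 8) (hj : j < 8) :
    B (joinU (c + 8) (8 * c) (c + 9) (8 * c + 8) k) i j =
      (B k i j || ((B k i (c + 1) || B k i c) && (B k (c + 1) j || B k c j))) := by
  have h := outer ((k >>> (8 * c + 8) ||| k >>> (8 * c)) &&& 65280)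
    ((k >>> (c + 9) ||| k >>> (c + 8)) &&& 72340172838076673) (by
      intro m hm
      simp only [Nat.testBit_and, tb_R, Bool.and_eq_true, decide_eq_true_eq] at hm
      exact hm.2) (by
      intro m hm
      simp only [Nat.testBit_and, tb_M, Bool.and_eq_true, decide_eq_true_eq] at hm
      exact hm.2.1) i j hj
  have e : joinU (c + 8) (8 * c) (c + 9) (8 * c + 8) k = k |||
    ((k >>> (8 * c + 8) ||| k >>> (8 * c)) &&& 65280) *
    ((k >>> (c + 9) ||| k >>> (c + 8)) &&& 72340172838076673) := rfl
  rw [e]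
  unfold B
  rw [Nat.testBit_or, h]
  simp only [Nat.testBit_and, Nat.testBit_or, tb_R, tb_M, Nat.testBit_shiftRight]
  rw [show c + 9 + 8 * i = 8 + 8 * i + (c + 1) by ring, show c + 8 + 8 * i = 8 + 8 * i + c by ring,
    show 8 * c + 8 + (8 + j) = 8 + 8 * (c + 1) + j by ring,
    show 8 * c + (8 + j) = 8 + 8 * c + j by ring]
  have a1 : 8 + j < 16 := by omega
  have a2 : 8 * i < 64 := by omega
  simp [a1, a2]

theorem joinU_C (c k m : ℕ) (hm : m < 8) :
    (joinU (c + 8) (8 * c) (c + 9) (8 * c + 8) k).testBit m = k.testBit m := by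
  have h := outer_lt ((k >>> (8 * c + 8) ||| k >>> (8 * c)) &&& 65280)
    ((k >>> (c + 9) ||| k >>> (c + 8)) &&& 72340172838076673) (by
      intro m hm
      simp only [Nat.testBit_and, tb_R, Bool.and_eq_true, decide_eq_true_eq] at hm
      exact hm.2) m hm
  have e : joinU (c + 8) (8 * c) (c + 9) (8 * c + 8) k = k |||
    ((k >>> (8 * c + 8) ||| k >>> (8 * c)) &&& 65280) *
    ((k >>> (c + 9) ||| k >>> (c + 8)) &&& 72340172838076673) := rfl
  rw [e, Nat.testBit_or, h, Bool.or_false]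

theorem joinL_B (c k i j : ℕ) (hi : i < 8) (hj : j < 8) (hc : c < 7) :
    B (joinL (c + 8) (8 * c) (2 ^ (c + 9)) (2 ^ (8 * c + 8)) k) i j =
      (B k i j || ((decide (i = c + 1) || B k i c) && (decide (j = c + 1) || B k c j))) := by
  have h := outer ((k >>> (8 * c)) &&& 65280 ||| 2 ^ (c + 9))
    ((k >>> (c + 8)) &&& 72340172838076673 ||| 2 ^ (8 * c + 8)) (by
      intro m hm
      simp only [Nat.testBit_and, Nat.testBit_or, tb_R, Bool.and_eq_true, Bool.or_eq_true,
        decide_eq_true_eq, Nat.testBit_two_pow] at hm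
      omega) (by
      intro m hm
      simp only [Nat.testBit_and, Nat.testBit_or, tb_M, Bool.and_eq_true, Bool.or_eq_true,
        decide_eq_true_eq, Nat.testBit_two_pow] at hm
      omega) i j hj
  have e : joinL (c + 8) (8 * c) (2 ^ (c + 9)) (2 ^ (8 * c + 8)) k = k |||
    ((k >>> (8 * c)) &&& 65280 ||| 2 ^ (c + 9)) *
    ((k >>> (c + 8)) &&& 72340172838076673 ||| 2 ^ (8 * c + 8)) := rfl
  rw [e]
  unfold B
  rw [Nat.testBit_or, h]
  simp only [Nat.testBit_and, Nat.testBit_or, tb_R, tb_M, Nat.testBit_shiftRight,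
    Nat.testBit_two_pow]
  rw [show c + 8 + 8 * i = 8 + 8 * i + c by ring,
    show 8 * c + (8 + j) = 8 + 8 * c + j by ring]
  have a1 : 8 + j < 16 := by omega
  have a2 : 8 * i < 64 := by omega
  have a3 : (8 * c + 8 = 8 * i) ↔ i = c + 1 := by omega
  have a4 : (c + 9 = 8 + j) ↔ j = c + 1 := by omega
  simp only [a1, a2, a3, a4, decide_true, Bool.and_true, Nat.mul_mod_right, Nat.le_add_right]
  rw [Bool.or_comm (k.testBit (8 + 8 * i + c)), Bool.or_comm (k.testBit (8 + 8 * c + j))]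

theorem joinL_C (c k m : ℕ) (hm : m < 8) (hc : c < 7) :
    (joinL (c + 8) (8 * c) (2 ^ (c + 9)) (2 ^ (8 * c + 8)) k).testBit m = k.testBit m := by
  have h := outer_lt ((k >>> (8 * c)) &&& 65280 ||| 2 ^ (c + 9))
    ((k >>> (c + 8)) &&& 72340172838076673 ||| 2 ^ (8 * c + 8)) (by
      intro m hm
      simp only [Nat.testBit_and, Nat.testBit_or, tb_R, Bool.and_eq_true, Bool.or_eq_true,
        decide_eq_true_eq, Nat.testBit_two_pow] at hm
      omega) m hm
  have e : joinL (c + 8) (8 * c) (2 ^ (c + 9)) (2 ^ (8 * c + 8)) k = k |||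
    ((k >>> (8 * c)) &&& 65280 ||| 2 ^ (c + 9)) *
    ((k >>> (c + 8)) &&& 72340172838076673 ||| 2 ^ (8 * c + 8)) := rfl
  rw [e, Nat.testBit_or, h, Bool.or_false]

theorem rec_bit {k c : ℕ} (a b : ℕ) :
    (Nat.rec a (fun _ _ => b) (Nat.land k (2 ^ c)) : ℕ) = if k.testBit c then b else a := by
  rcases e : Nat.land k (2 ^ c) with _ | n
  · rw [land_two_pow_zero e]
    rfl
  · rw [land_two_pow_succ e]
    rfl

theorem nw_succ (K : Bool) (c k : ℕ) : nw K (c + 1) k = if k.testBit c = K then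
    joinL (c + 8) (8 * c) (2 ^ (c + 9)) (2 ^ (8 * c + 8)) k else k ||| 2 ^ (9 * c + 17) := by
  unfold nw
  cases K
  · simp only [nF, newF, rec_bit]
    cases k.testBit c <;> rfl
  · simp only [nT, newT, rec_bit]
    cases k.testBit c <;> rfl

theorem sm_succ (K : Bool) (c k : ℕ) : sm K (c + 1) k =
    if B k (c + 1) c = false ∧ k.testBit c = K then
    joinU (c + 8) (8 * c) (c + 9) (8 * c + 8) k else k := by
  have e : B k (c + 1) c = k.testBit (9 * c + 16) := by
    unfold B
    congr 1
    ring
  unfold sm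
  rw [e]
  cases K
  · simp only [sF, sameF, rec_bit]
    cases k.testBit c <;> cases k.testBit (9 * c + 16) <;> rfl
  · simp only [sT, sameT, rec_bit]
    cases k.testBit c <;> cases k.testBit (9 * c + 16) <;> rfl

theorem nw_C (K : Bool) (c k m : ℕ) (hc : c < 8) (hm : m < 8) :
    (nw K c k).testBit m = k.testBit m := by
  cases c with
  | zero =>
    have : nw K 0 k = k ||| 2 ^ 8 := by cases K <;> rfl
    rw [this, Nat.testBit_or, Nat.testBit_two_pow]
    simp
    omega
  | succ c =>
    rw [nw_succ]
    split_ifs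
    · exact joinL_C _ _ _ hm (by omega)
    · rw [Nat.testBit_or, Nat.testBit_two_pow]
      simp
      omega

theorem sm_C (K : Bool) (c k m : ℕ) (hm : m < 8) :
    (sm K c k).testBit m = k.testBit m := by
  cases c with
  | zero =>
    have : sm K 0 k = k := by cases K <;> rfl
    rw [this]
  | succ c =>
    rw [sm_succ]
    split_ifs
    · exact joinU_C _ _ _ hm
    · rfl

theorem nw_B (K : Bool) (c k i j : ℕ) (hc : c < 8) (hi : i < 8) (hj : j < 8) :
    B (nw K c k) i j = true ↔ B k i j = true ∨
      (i = c ∨ (c ≠ 0 ∧ k.testBit (c - 1) = K) ∧ B k i (c - 1) = true) ∧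
      (j = c ∨ (c ≠ 0 ∧ k.testBit (c - 1) = K) ∧ B k (c - 1) j = true) := by
  cases c with
  | zero =>
    have : nw K 0 k = k ||| 2 ^ 8 := by cases K <;> rfl
    rw [this]
    unfold B
    have e : (8 = 8 + 8 * i + j) ↔ (i = 0 ∧ j = 0) := by omega
    rw [Nat.testBit_or, Nat.testBit_two_pow]
    simp only [e, Bool.or_eq_true, decide_eq_true_eq]
    simp
  | succ c =>
    rw [nw_succ]
    split_ifs with h
    · rw [joinL_B _ _ _ _ hi hj (by omega)]
      simp [h]
    · unfold B
      have e : (9 * c + 17 = 8 + 8 * i + j) ↔ (i = c + 1 ∧ j = c + 1) := by omega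
      rw [Nat.testBit_or, Nat.testBit_two_pow]
      simp only [e, Bool.or_eq_true, decide_eq_true_eq]
      simp [h]

theorem sm_B (K : Bool) (c k i j : ℕ) (hi : i < 8) (hj : j < 8) :
    B (sm K c k) i j = true ↔ B k i j = true ∨ (c ≠ 0 ∧ k.testBit (c - 1) = K) ∧
      B k c (c - 1) = false ∧ 
      (B k i c = true ∨ B k i (c - 1) = true) ∧ (B k c j = true ∨ B k (c - 1) j = true) := by
  cases c with
  | zero =>
    have : sm K 0 k = k := by cases K <;> rfl
    rw [this]
    simp
  | succ c =>
    rw [sm_succ]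
    split_ifs with h
    · rw [joinU_B _ _ _ _ hi hj]
      simp [h]
    · constructor
      · exact Or.inl
      · rintro (h' | ⟨⟨_, h1⟩, h2, _⟩)
        · exact h'
        · exact absurd ⟨h2, h1⟩ h

theorem tb_rx : ∀ c < 8, ∀ i < 8, ∀ j < 8,
    (rxc c).testBit (8 + 8 * i + j) = (decide (i = c) && decide (j ≠ c)) := by decide +kernel

theorem tb_rx2 (c : ℕ) (hc : c < 8) (m : ℕ) (h : (rxc c).testBit m = true) : 8 ≤ m ∧ m < 72 := by
  have h1 : ∀ c < 8, rxc c < 2 ^ 72 ∧ ∀ m < 8, (rxc c).testBit m = false := by decide +kernel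
  constructor
  · by_contra hh
    rw [(h1 c hc).2 m (by omega)] at h
    exact absurd h (by decide)
  · by_contra hh
    rw [Nat.testBit_lt_two_pow ((h1 c hc).1.trans_le (Nat.pow_le_pow_right (by omega) (by omega)))]
      at h
    exact absurd h (by decide)

theorem tb_nm : ∀ c < 8, ∀ i < 8, ∀ j < 8,
    (nmc c).testBit (8 + 8 * i + j) = (decide (i ≠ c) && decide (j ≠ c)) := by decide +kernel

theorem tb_nmC : ∀ c < 8, ∀ i < 8, (nmc c).testBit i = true := by decide +kernel

theorem tb_255 (m : ℕ) : (255).testBit m = decide (m < 8) := by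
  have : 255 = 2 ^ 8 - 1 := by norm_num
  rw [this, Nat.testBit_two_pow_sub_one]

theorem alone_iff (c k : ℕ) (hc : c < 8) :
    k &&& rxc c = 0 ↔ ∀ j < 8, j ≠ c → B k c j = false := by
  constructor
  · intro h j hj hjc
    have := congrArg (fun x => x.testBit (8 + 8 * c + j)) h
    simp only [Nat.testBit_and, Nat.zero_testBit, tb_rx c hc c hc j hj] at this
    simpa [B, hjc] using this
  · intro h
    apply Nat.eq_of_testBit_eq
    intro m
    rw [Nat.zero_testBit, Nat.testBit_and]
    by_contra hh
    simp only [Bool.not_eq_false, Bool.and_eq_true] at hh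
    obtain ⟨h1, h2⟩ := hh
    have h3 := tb_rx2 c hc m h2
    have e : m = 8 + 8 * ((m - 8) / 8) + m % 8 := by omega
    rw [e, tb_rx c hc _ (by omega) _ (by omega)] at h2
    simp only [Bool.and_eq_true, decide_eq_true_eq] at h2
    have h4 := h (m % 8) (by omega) h2.2
    unfold B at h4
    rw [← h2.1, ← e, h1] at h4
    exact absurd h4 (by decide)

theorem diff_B (c k i j : ℕ) (hc : c < 8) (hi : i < 8) (hj : j < 8) :
    B ((k &&& nmc c) ^^^ 2 ^ c) i j = (B k i j && (decide (i ≠ c) && decide (j ≠ c))) := by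
  unfold B
  have : ¬ c = 8 + 8 * i + j := by omega
  rw [Nat.testBit_xor, Nat.testBit_and, tb_nm c hc i hi j hj, Nat.testBit_two_pow]
  simp [this]

theorem diff_C (c k i : ℕ) (hc : c < 8) (hi : i < 8) :
    ((k &&& nmc c) ^^^ 2 ^ c).testBit i = (k.testBit i ^^ decide (c = i)) := by
  rw [Nat.testBit_xor, Nat.testBit_and, tb_nmC c hc i hi, Nat.testBit_two_pow]
  simp

theorem mono_C (c k i : ℕ) (hi : i < 8) :
    ((k &&& 255) ^^^ 2 ^ c).testBit i = (k.testBit i ^^ decide (c = i)) := by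
  rw [Nat.testBit_xor, Nat.testBit_and, tb_255, Nat.testBit_two_pow]
  simp [hi]

theorem mono_lt (c k : ℕ) (hc : c < 8) : ((k &&& 255) ^^^ 2 ^ c) < 2 ^ 8 := by
  apply Nat.xor_lt_two_pow
  · exact Nat.and_lt_two_pow _ (by norm_num)
  · exact Nat.pow_lt_pow_right (by omega) hc

theorem eq_zero_iff (C : ℕ) (h : C < 2 ^ 8) : C = 0 ↔ ∀ i < 8, C.testBit i = false := by
  constructor
  · rintro rfl i _
    simp
  · intro h'
    apply Nat.eq_of_testBit_eq
    intro m
    rw [Nat.zero_testBit]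
    by_cases hm : m < 8
    · exact h' m hm
    · exact Nat.testBit_lt_two_pow (h.trans_le (Nat.pow_le_pow_right (by omega) (by omega)))

theorem eq_255_iff (C : ℕ) (h : C < 2 ^ 8) : C = 255 ↔ ∀ i < 8, C.testBit i = true := by
  constructor
  · rintro rfl i hi
    simp [tb_255, hi]
  · intro h'
    apply Nat.eq_of_testBit_eq
    intro m
    rw [tb_255]
    by_cases hm : m < 8
    · simp [h' m hm, hm]
    · rw [Nat.testBit_lt_two_pow (h.trans_le (Nat.pow_le_pow_right (by omega) (by omega)))]
      simp [hm]

end GM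

namespace GM

/-! ### Connectivity of partially coloured boards

The cell in row `r` and column `c` has index `8 + 8 * r + c`. -/

/-- Grid adjacency of indices. -/
def adj (x y : ℕ) : Prop :=
  8 ≤ x ∧ 8 ≤ y ∧ (y = x + 8 ∨ x = y + 8 ∨ (y = x + 1 ∧ y % 8 ≠ 0) ∨ (x = y + 1 ∧ x % 8 ≠ 0))

/-- Adjacent cells of the same colour. -/
def E (F : Finset ℕ) (x y : ℕ) : Prop := adj x y ∧ (x ∈ F ↔ y ∈ F)

/-- Adjacent cells of the same colour, both with index below `t`. -/
def R (F : Finset ℕ) (t x y : ℕ) : Prop := x < t ∧ y < t ∧ E F x y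

/-- Monochromatic connectivity among the cells of index below `t`. -/
def Conn (F : Finset ℕ) (t : ℕ) : ℕ → ℕ → Prop := Relation.ReflTransGen (R F t)

variable {F : Finset ℕ} {t a b x : ℕ}

theorem R_symm {y : ℕ} (h : R F t x y) : R F t y x := by
  obtain ⟨h1, h2, ⟨h3, h4, h5⟩, h6⟩ := h
  refine ⟨h2, h1, ⟨h4, h3, ?_⟩, h6.symm⟩
  tauto

theorem Conn.symm (h : Conn F t a b) : Conn F t b a := by
  induction h with
  | refl => exact .refl
  | tail _ h ih => exact Relation.ReflTransGen.head (R_symm h) ih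

theorem Conn.trans (h : Conn F t a b) (h' : Conn F t b x) : Conn F t a x :=
  Relation.ReflTransGen.trans h h'

theorem Conn.mono (h : Conn F t a b) : Conn F (t + 1) a b := by
  induction h with
  | refl => exact .refl
  | tail _ h ih => 
    exact Relation.ReflTransGen.tail ih
      ⟨h.1.trans (Nat.lt_succ_self _), h.2.1.trans (Nat.lt_succ_self _), h.2.2⟩

theorem Conn.col (h : Conn F t a b) : a ∈ F ↔ b ∈ F := by
  induction h with
  | refl => rfl
  | tail _ h ih => exact ih.trans h.2.2.2

theorem Conn.bd (h : Conn F t a b) : a = b ∨ (8 ≤ a ∧ a < t ∧ 8 ≤ b ∧ b < t) := by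
  induction h with
  | refl => exact Or.inl rfl
  | tail _ h ih =>
    obtain ⟨h1, h2, ⟨h3, h4, h5⟩, h6⟩ := h
    right
    rcases ih with rfl | ih
    · exact ⟨h3, h1, h4, h2⟩
    · exact ⟨ih.1, ih.2.1, h4, h2⟩

/-- The cells that are connected to the new cell `t`. -/
def P (F : Finset ℕ) (t a : ℕ) : Prop := a = t ∨ (16 ≤ t ∧ (t - 8 ∈ F ↔ t ∈ F) ∧ Conn F t (t - 8) a) ∨
  (t % 8 ≠ 0 ∧ (t - 1 ∈ F ↔ t ∈ F) ∧ Conn F t (t - 1) a)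

theorem P_of (hx : x < t) (h : E F x t) (h' : Conn F t x a) : P F t a := by
  obtain ⟨⟨h3, h4, h5⟩, h6⟩ := h
  rcases h5 with h5 | h5 | h5 | h5
  · right; left
    have : x = t - 8 := by omega
    subst this
    exact ⟨by omega, h6, h'⟩
  · omega
  · right; right
    have : x = t - 1 := by omega
    subst this
    exact ⟨h5.2, h6, h'⟩
  · omega

theorem P.conn (ht : 8 ≤ t) (h : P F t a) : Conn F (t + 1) t a := by
  rcases h with rfl | ⟨h1, h2, h3⟩ | ⟨h1, h2, h3⟩
  · exact .refl
  · refine Relation.ReflTransGen.head ⟨by omega, ?_, ⟨by omega, ?_, ?_⟩, h2.symm⟩ h3.mono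
    all_goals omega
  · refine Relation.ReflTransGen.head ⟨by omega, ?_, ⟨by omega, ?_, ?_⟩, h2.symm⟩ h3.mono
    all_goals omega

theorem P.step {y : ℕ} (h : P F t a) (ha : a < t) (h' : R F t a y) : P F t y := by
  rcases h with rfl | ⟨h1, h2, h3⟩ | ⟨h1, h2, h3⟩
  · omega
  · exact Or.inr (Or.inl ⟨h1, h2, Relation.ReflTransGen.tail h3 h'⟩)
  · exact Or.inr (Or.inr ⟨h1, h2, Relation.ReflTransGen.tail h3 h'⟩)

theorem conn_succ (ht : 8 ≤ t) : Conn F (t + 1) a b ↔ Conn F t a b ∨ (P F t a ∧ P F t b) := by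
  constructor
  · intro h
    induction h with
    | refl => exact Or.inl .refl
    | @tail b y h1 h ih =>
      have hR := h
      obtain ⟨hb, hy, hE⟩ := h
      by_cases hbt : b = t
      · subst hbt
        have hyb : y < b := by
          rcases hE with ⟨⟨_, _, h5⟩, _⟩
          omega
        have hPy : P F b y := P_of hyb (R_symm hR).2.2 .refl
        right
        refine ⟨?_, hPy⟩
        rcases ih with ih | ih
        · rcases ih.bd with rfl | h'
          · exact Or.inl rfl
          · omega
        · exact ih.1
      · by_cases hyt : y = t
        · subst hyt
          right
          refine ⟨?_, Or.inl rfl⟩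
          rcases ih with ih | ih
          · exact P_of (by omega) hE ih.symm
          · exact ih.1
        · have hR' : R F t b y := ⟨by omega, by omega, hE⟩
          rcases ih with ih | ih
          · exact Or.inl (Relation.ReflTransGen.tail ih hR')
          · exact Or.inr ⟨ih.1, ih.2.step (by omega) hR'⟩
  · rintro (h | ⟨h1, h2⟩)
    · exact h.mono
    · exact (h1.conn ht).symm.trans (h2.conn ht)

/-- The frontier cell of column `i` at time `t`. -/
def w (t i : ℕ) : ℕ := if i < t % 8 then t - t % 8 + i else t - t % 8 - 8 + i

theorem w_succ (ht : 8 ≤ t) {i : ℕ} (hi : i < 8) :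
    w (t + 1) i = if i = t % 8 then t else w t i := by
  unfold w
  split_ifs <;> omega

theorem w_c (ht : 8 ≤ t) : w t (t % 8) = t - 8 := by
  unfold w
  split_ifs <;> omega

theorem w_c1 (ht : 8 ≤ t) (h : t % 8 ≠ 0) : w t (t % 8 - 1) = t - 1 := by
  unfold w
  split_ifs <;> omega

theorem w_lt (ht : 8 ≤ t) {i : ℕ} (hi : i < 8) : w t i < t := by
  unfold w
  split_ifs <;> omega

theorem w_real (ht : 16 ≤ t) (i : ℕ) : 8 ≤ w t i := by
  unfold w
  split_ifs <;> omega

theorem w_surj (ht : 8 ≤ t) (h1 : t ≤ x + 8) (h2 : x < t) : ∃ i < 8, w t i = x := by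
  refine ⟨x % 8, by omega, ?_⟩
  unfold w
  split_ifs <;> omega

/-- The state describes the frontier faithfully, no component is closed. -/
structure Normal (F : Finset ℕ) (t k : ℕ) : Prop where
  hB : ∀ i < 8, ∀ j < 8, (B k i j = true ↔ 8 ≤ w t i ∧ 8 ≤ w t j ∧ Conn F t (w t i) (w t j))
  hC : ∀ i < 8, (k.testBit i = true ↔ w t i ∈ F)
  hcov : ∀ a, 8 ≤ a → a < t → ∃ i < 8, Conn F t (w t i) a

/-- Colour `κ` is complete. -/
structure Sink (F : Finset ℕ) (t k : ℕ) (κ : Bool) : Prop where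
  ht : 16 ≤ t
  s1 : ∃ a, 8 ≤ a ∧ a < t ∧ (a ∈ F ↔ κ = true)
  s2 : ∀ a b, 8 ≤ a → a < t → 8 ≤ b → b < t → (a ∈ F ↔ κ = true) → (b ∈ F ↔ κ = true) → Conn F t a b
  s3 : ∀ i < 8, ¬ (w t i ∈ F ↔ κ = true)
  s4 : ∀ a, 8 ≤ a → a < t → ¬ (a ∈ F ↔ κ = true) → ∃ i < 8, Conn F t (w t i) a
  s5 : k = if κ then 0 else 255

/-- Some colour class can no longer be connected. -/
def Dead (F : Finset ℕ) (t : ℕ) : Prop :=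
  ∃ a b, 8 ≤ a ∧ a < t ∧ 8 ≤ b ∧ b < t ∧ (a ∈ F ↔ b ∈ F) ∧ (∀ x, Conn F t a x → x + 8 < t) ∧
    ¬ Conn F t a b

theorem Dead.succ (ht : 8 ≤ t) (h : Dead F t) : Dead F (t + 1) := by
  obtain ⟨a, b, h1, h2, h3, h4, h5, h6, h7⟩ := h
  have hP : ¬ P F t a := by
    rintro (rfl | ⟨h1, h2, h3⟩ | ⟨h1, h2, h3⟩)
    · omega
    · have := h6 _ h3.symm
      omega
    · have := h6 _ h3.symm
      omega
  have key : ∀ x, Conn F (t + 1) a x → Conn F t a x := by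
    intro x hx
    rcases (conn_succ ht).1 hx with h | h
    · exact h
    · exact absurd h.1 hP
  exact ⟨a, b, h1, by omega, h3, by omega, h5, fun x hx => (h6 x (key x hx)).trans (by omega),
    fun h => h7 (key b h)⟩

theorem not_conn_new (ha : a ≠ t) : ¬ Conn F t a t := by
  intro h
  rcases h.bd with h | h
  · exact ha h
  · omega

theorem normal_zero (hF : ∀ x ∈ F, 8 ≤ x) : Normal F 8 0 where
  hB := by
    intro i hi j hj
    have : ¬ 8 ≤ w 8 i := by
      unfold w
      split_ifs <;> omega
    simp [B, this]
  hC := by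
    intro i hi
    have : w 8 i ∉ F := by
      intro h
      have h2 := hF _ h
      unfold w at h2
      split_ifs at h2 <;> omega
    simp [this]
  hcov := by
    intro a h1 h2
    omega

theorem new_step (ht : 8 ≤ t) {k k1 : ℕ} {K : Bool} (hK : K = true ↔ t ∈ F) (hN : Normal F t k)
    (hU : ¬ (16 ≤ t ∧ (t - 8 ∈ F ↔ t ∈ F)))
    (hB1 : ∀ i < 8, ∀ j < 8, (B k1 i j = true ↔ B k i j = true ∧ i ≠ t % 8 ∧ j ≠ t % 8))
    (hC1 : ∀ i < 8, (k1.testBit i = true ↔ w (t + 1) i ∈ F))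
    (hcv : t < 16 ∨ ∃ j < 8, j ≠ t % 8 ∧ B k (t % 8) j = true) :
    Normal F (t + 1) (nw K (t % 8) k1) where
  hB := by
    intro i hi j hj
    have hc : t % 8 < 8 := Nat.mod_lt _ (by omega)
    rw [nw_B K _ _ _ _ hc hi hj, conn_succ ht]
    have hpL : t % 8 ≠ 0 → (k1.testBit (t % 8 - 1) = K ↔ (t - 1 ∈ F ↔ t ∈ F)) := by
      intro h0
      have := hC1 (t % 8 - 1) (by omega)
      rw [w_succ ht (by omega), if_neg (by omega), w_c1 ht h0] at this
      rw [← this, ← hK, Bool.eq_iff_iff]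
    have hPi : ∀ i < 8, i ≠ t % 8 → 
        (P F t (w t i) ↔ (t % 8 ≠ 0 ∧ (t - 1 ∈ F ↔ t ∈ F)) ∧ Conn F t (t - 1) (w t i)) := by
      intro i hi hic
      have := w_lt ht hi
      unfold P
      constructor
      · rintro (h | h | h)
        · omega
        · exact absurd ⟨h.1, h.2.1⟩ hU
        · exact ⟨⟨h.1, h.2.1⟩, h.2.2⟩
      · rintro ⟨⟨h1, h2⟩, h3⟩
        exact Or.inr (Or.inr ⟨h1, h2, h3⟩)
    have hreal : t % 8 ≠ 0 → 8 ≤ t - 1 := by omega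
    have hB' : ∀ i < 8, i ≠ t % 8 → ((t % 8 ≠ 0 ∧ k1.testBit (t % 8 - 1) = K) ∧ 
        B k1 i (t % 8 - 1) = true ↔ P F t (w t i) ∧ 8 ≤ w t i) := by
      intro i hi hic
      rw [hPi i hi hic]
      by_cases h0 : t % 8 = 0
      · simp [h0]
      · rw [hpL h0, hB1 _ hi _ (by omega), hN.hB _ hi _ (by omega), w_c1 ht h0]
        have h1 : t % 8 - 1 ≠ t % 8 := by omega
        have h2 := hreal h0
        constructor
        · rintro ⟨h3, ⟨h4, h5, h6⟩, h7⟩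
          exact ⟨⟨h3, h6.symm⟩, h4⟩
        · rintro ⟨⟨h3, h4⟩, h5⟩
          exact ⟨h3, ⟨h5, h2, h4.symm⟩, hic, h1⟩
    have hB'' : ∀ i < 8, i ≠ t % 8 → ((t % 8 ≠ 0 ∧ k1.testBit (t % 8 - 1) = K) ∧ 
        B k1 (t % 8 - 1) i = true ↔ P F t (w t i) ∧ 8 ≤ w t i) := by
      intro i hi hic
      rw [hPi i hi hic]
      by_cases h0 : t % 8 = 0
      · simp [h0]
      · rw [hpL h0, hB1 _ (by omega) _ hi, hN.hB _ (by omega) _ hi, w_c1 ht h0]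
        have h1 : t % 8 - 1 ≠ t % 8 := by omega
        have h2 := hreal h0
        constructor
        · rintro ⟨h3, ⟨h4, h5, h6⟩, h7⟩
          exact ⟨⟨h3, h6⟩, h5⟩
        · rintro ⟨⟨h3, h4⟩, h5⟩
          exact ⟨h3, ⟨h2, h5, h4⟩, h1, hic⟩
    have hPt : P F t t := Or.inl rfl
    rw [w_succ ht hi, w_succ ht hj, hB1 i hi j hj, hN.hB i hi j hj]
    by_cases hic : i = t % 8
    · by_cases hjc : j = t % 8
      · rw [if_pos hic, if_pos hjc]
        exact ⟨fun _ => ⟨ht, ht, Or.inr ⟨hPt, hPt⟩⟩, fun _ => Or.inr ⟨Or.inl hic, Or.inl hjc⟩⟩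
      · rw [if_pos hic, if_neg hjc, hB'' j hj hjc]
        have h3 : ¬ Conn F t t (w t j) := fun h => 
          not_conn_new (by have := w_lt ht hj; omega) h.symm
        constructor
        · rintro (⟨_, h, _⟩ | ⟨_, h | h⟩)
          · exact absurd hic h
          · exact absurd h hjc
          · exact ⟨ht, h.2, Or.inr ⟨hPt, h.1⟩⟩
        · rintro ⟨_, h1, h | h⟩
          · exact absurd h h3
          · exact Or.inr ⟨Or.inl hic, Or.inr ⟨h.2, h1⟩⟩
    · by_cases hjc : j = t % 8
      · rw [if_neg hic, if_pos hjc, hB' i hi hic]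
        have h3 : ¬ Conn F t (w t i) t := fun h => 
          not_conn_new (by have := w_lt ht hi; omega) h
        constructor
        · rintro (⟨_, _, h⟩ | ⟨h | h, _⟩)
          · exact absurd hjc h
          · exact absurd h hic
          · exact ⟨h.2, ht, Or.inr ⟨h.1, hPt⟩⟩
        · rintro ⟨h1, _, h | h⟩
          · exact absurd h h3
          · exact Or.inr ⟨Or.inr ⟨h.1, h1⟩, Or.inl hjc⟩
      · rw [if_neg hic, if_neg hjc, hB' i hi hic, hB'' j hj hjc]
        constructor
        · rintro (⟨h, _⟩ | ⟨h | h, h' | h'⟩)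
          · exact ⟨h.1, h.2.1, Or.inl h.2.2⟩
          · exact absurd h hic
          · exact absurd h hic
          · exact absurd h' hjc
          · exact ⟨h.2, h'.2, Or.inr ⟨h.1, h'.1⟩⟩
        · rintro ⟨h1, h2, h | h⟩
          · exact Or.inl ⟨⟨h1, h2, h⟩, hic, hjc⟩
          · exact Or.inr ⟨Or.inr ⟨h.1, h1⟩, Or.inr ⟨h.2, h2⟩⟩
  hC := by
    intro i hi
    rw [nw_C _ _ _ _ (Nat.mod_lt _ (by omega)) hi, hC1 i hi]
  hcov := by
    intro a ha hat
    have hc : t % 8 < 8 := Nat.mod_lt _ (by omega)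
    by_cases h : a = t
    · refine ⟨t % 8, hc, ?_⟩
      rw [w_succ ht hc, if_pos rfl, h]
      exact .refl
    · obtain ⟨i, hi, hia⟩ := hN.hcov a ha (by omega)
      by_cases hic : i = t % 8
      · subst hic
        rcases hcv with h16 | ⟨j, hj, hjc, hj'⟩
        · rw [w_c ht] at hia
          rcases hia.bd with h | h <;> omega
        · have h2 := ((hN.hB _ hc _ hj).1 hj').2.2
          refine ⟨j, hj, ?_⟩
          rw [w_succ ht hj, if_neg hjc]
          exact (h2.symm.trans hia).mono
      · refine ⟨i, hi, ?_⟩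
        rw [w_succ ht hi, if_neg hic]
        exact hia.mono

theorem same_step (ht : 16 ≤ t) {k : ℕ} {K : Bool} (hK : K = true ↔ t ∈ F) (hN : Normal F t k)
    (hS : k.testBit (t % 8) = K) : Normal F (t + 1) (sm K (t % 8) k) where
  hB := by
    intro i hi j hj
    have ht8 : 8 ≤ t := by omega
    have hc : t % 8 < 8 := Nat.mod_lt _ (by omega)
    rw [sm_B K _ _ _ _ hi hj, conn_succ ht8]
    have hU : t - 8 ∈ F ↔ t ∈ F := by
      rw [← hK, ← hS, hN.hC _ hc, w_c ht8]
    have hpL : (t % 8 ≠ 0 ∧ k.testBit (t % 8 - 1) = K) ↔ (t % 8 ≠ 0 ∧ (t - 1 ∈ F ↔ t ∈ F)) := by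
      by_cases h0 : t % 8 = 0
      · simp [h0]
      · have := hN.hC (t % 8 - 1) (by omega)
        rw [w_c1 ht8 h0] at this
        rw [← this, ← hK, Bool.eq_iff_iff]
    have hB' : ∀ i < 8, ∀ j < 8, (B k i j = true ↔ Conn F t (w t i) (w t j)) := by
      intro i hi j hj
      rw [hN.hB i hi j hj]
      exact ⟨fun h => h.2.2, fun h => ⟨w_real ht i, w_real ht j, h⟩⟩
    have hPi : ∀ i < 8, (P F t (w (t + 1) i) ↔ B k i (t % 8) = true ∨ 
        (t % 8 ≠ 0 ∧ k.testBit (t % 8 - 1) = K) ∧ B k i (t % 8 - 1) = true) := by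
      intro i hi
      rw [w_succ ht8 hi, hpL, hB' _ hi _ hc, w_c ht8]
      by_cases hic : i = t % 8
      · rw [if_pos hic, hic, w_c ht8]
        exact ⟨fun _ => Or.inl .refl, fun _ => Or.inl rfl⟩
      · rw [if_neg hic]
        have := w_lt ht8 hi
        constructor
        · rintro (h | h | h)
          · omega
          · exact Or.inl h.2.2.symm
          · refine Or.inr ⟨⟨h.1, h.2.1⟩, ?_⟩
            rw [hB' _ hi _ (by omega), w_c1 ht8 h.1]
            exact h.2.2.symm
        · rintro (h | ⟨h1, h2⟩)
          · exact Or.inr (Or.inl ⟨ht, hU, h.symm⟩)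
          · rw [hB' _ hi _ (by omega), w_c1 ht8 h1.1] at h2
            exact Or.inr (Or.inr ⟨h1.1, h1.2, h2.symm⟩)
    have hsy : ∀ i < 8, ∀ j < 8, (B k i j = true ↔ B k j i = true) := by
      intro i hi j hj
      rw [hB' i hi j hj, hB' j hj i hi]
      exact ⟨Conn.symm, Conn.symm⟩
    have htr : ∀ i < 8, ∀ j < 8, ∀ l < 8, B k i j = true → B k j l = true → B k i l = true := by
      intro i hi j hj l hl
      rw [hB' i hi j hj, hB' j hj l hl, hB' i hi l hl]
      exact Conn.trans
    have hrf : ∀ i < 8, B k i i = true := by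
      intro i hi
      rw [hB' i hi i hi]
      exact .refl
    have hc1 : t % 8 - 1 < 8 := by omega
    have hmain : (Conn F t (w (t + 1) i) (w (t + 1) j) ∨ P F t (w (t + 1) i) ∧ P F t (w (t + 1) j))
        ↔ (B k i j = true ∨ P F t (w (t + 1) i) ∧ P F t (w (t + 1) j)) := by
      rw [hPi i hi, hPi j hj, w_succ ht8 hi, w_succ ht8 hj]
      by_cases hic : i = t % 8
      · subst hic
        have h1 := hrf _ hi
        by_cases hjc : j = t % 8
        · subst hjc
          exact ⟨fun _ => Or.inl h1, fun _ => Or.inr ⟨Or.inl h1, Or.inl h1⟩⟩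
        · rw [if_pos rfl, if_neg hjc]
          have h3 : ¬ Conn F t t (w t j) := fun h => 
            not_conn_new (by have := w_lt ht8 hj; omega) h.symm
          constructor
          · rintro (h | h)
            · exact absurd h h3
            · exact Or.inr h
          · rintro (h | h)
            · exact Or.inr ⟨Or.inl h1, Or.inl ((hsy _ hi _ hj).1 h)⟩
            · exact Or.inr h
      · by_cases hjc : j = t % 8
        · subst hjc
          have h1 := hrf _ hj
          rw [if_neg hic, if_pos rfl]
          have h3 : ¬ Conn F t (w t i) t := fun h => 
            not_conn_new (by have := w_lt ht8 hi; omega) h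
          constructor
          · rintro (h | h)
            · exact absurd h h3
            · exact Or.inr h
          · rintro (h | h)
            · exact Or.inr ⟨Or.inl h, Or.inl h1⟩
            · exact Or.inr h
        · rw [if_neg hic, if_neg hjc, hB' i hi j hj]
    have hr := fun i => w_real (show 16 ≤ t + 1 by omega) i
    rw [hmain, hPi i hi, hPi j hj, hsy _ hc _ hj, hsy _ hc1 _ hj]
    have t1 := htr i hi (t % 8) hc j hj
    have t2 := htr i hi (t % 8 - 1) hc1 j hj
    have t3 := htr i hi (t % 8) hc (t % 8 - 1) hc1
    have t4 := htr i hi (t % 8 - 1) hc1 (t % 8) hc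
    rw [hsy _ hc _ hj] at t1
    rw [hsy _ hc1 _ hj] at t2
    rw [hsy _ hc1 _ hc] at t4
    have r1 := hr i
    have r2 := hr j
    generalize (t % 8 ≠ 0 ∧ k.testBit (t % 8 - 1) = K) = pL at *
    generalize B k i j = b1 at *
    generalize B k i (t % 8) = b2 at *
    generalize B k j (t % 8) = b3 at *
    generalize B k i (t % 8 - 1) = b4 at *
    generalize B k j (t % 8 - 1) = b5 at *
    generalize B k (t % 8) (t % 8 - 1) = b6 at *
    clear hPi hmain hpL hsy htr hrf hB'
    by_cases pL
    all_goals revert b1 b2 b3 b4 b5 b6; simp_all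
  hC := by
    intro i hi
    have ht8 : 8 ≤ t := by omega
    rw [sm_C _ _ _ _ hi, w_succ ht8 hi]
    split_ifs with h
    · rw [h, hS, hK]
    · exact hN.hC i hi
  hcov := by
    intro a ha hat
    have ht8 : 8 ≤ t := by omega
    have hc : t % 8 < 8 := Nat.mod_lt _ (by omega)
    have hU : t - 8 ∈ F ↔ t ∈ F := by
      rw [← hK, ← hS, hN.hC _ hc, w_c ht8]
    by_cases h : a = t
    · refine ⟨t % 8, hc, ?_⟩
      rw [w_succ ht8 hc, if_pos rfl, h]
      exact .refl
    · obtain ⟨i, hi, hia⟩ := hN.hcov a ha (by omega)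
      by_cases hic : i = t % 8
      · subst hic
        rw [w_c ht8] at hia
        refine ⟨t % 8, hc, ?_⟩
        rw [w_succ ht8 hc, if_pos rfl]
        exact P.conn ht8 (Or.inr (Or.inl ⟨ht, hU, hia⟩))
      · refine ⟨i, hi, ?_⟩
        rw [w_succ ht8 hi, if_neg hic]
        exact hia.mono

end GM

namespace GM

variable {F : Finset ℕ} {t a b x : ℕ}

/-- The invariant of the automaton. -/
def Inv (F : Finset ℕ) (t : ℕ) : Option ℕ → Prop
  | none => Dead F t
  | some k => Normal F t k ∨ ∃ κ, Sink F t k κ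

theorem bool_ne {p : Prop} {x y : Bool} (hp : x = true ↔ p) (h : ¬ (p ↔ y = true)) : x = !y := by
  cases x <;> cases y <;> simp_all

theorem alone_step (ht : 16 ≤ t) {k : ℕ} {K : Bool} (hK : K = true ↔ t ∈ F) (hN : Normal F t k)
    (hS : k.testBit (t % 8) ≠ K) (hal : ∀ j < 8, j ≠ t % 8 → B k (t % 8) j = false) :
    Inv F (t + 1) (if (k &&& 255) ^^^ 2 ^ (t % 8) = 0 ∨ (k &&& 255) ^^^ 2 ^ (t % 8) = 255 then
      some ((k &&& 255) ^^^ 2 ^ (t % 8)) else none) := by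
  have ht8 : 8 ≤ t := by omega
  have hc : t % 8 < 8 := Nat.mod_lt _ (by omega)
  have hD : ¬ (t - 8 ∈ F ↔ t ∈ F) := by
    rw [← hK, ← w_c ht8, ← hN.hC _ hc, ← Bool.eq_iff_iff]
    exact hS
  have hal' : ∀ j < 8, j ≠ t % 8 → ¬ Conn F t (t - 8) (w t j) := by
    intro j hj hjc h
    have h1 := hal j hj hjc
    have h2 := (hN.hB _ hc _ hj).2
    rw [w_c ht8, h1] at h2
    exact absurd (h2 ⟨by omega, w_real ht j, h⟩) (by decide)
  have hP : ¬ P F t (t - 8) := by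
    rintro (h | h | h)
    · omega
    · exact hD h.2.1
    · have := hal' (t % 8 - 1) (by omega) (by omega)
      rw [w_c1 ht8 h.1] at this
      exact this h.2.2.symm
  have key : ∀ x, Conn F (t + 1) (t - 8) x → Conn F t (t - 8) x := by
    intro x hx
    rcases (conn_succ ht8).1 hx with h | h
    · exact h
    · exact absurd h.1 hP
  have hcl : ∀ x, Conn F (t + 1) (t - 8) x → x + 8 < t + 1 := by
    intro x hx
    have h := key x hx
    by_contra hh
    have hxt : x < t := by
      rcases h.bd with h | h <;> omega
    obtain ⟨i, hi, rfl⟩ := w_surj ht8 (by omega) hxt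
    by_cases hic : i = t % 8
    · rw [hic, w_c ht8] at hh
      omega
    · exact hal' i hi hic h
  have hCb : ∀ i < 8, (((k &&& 255) ^^^ 2 ^ (t % 8)).testBit i = true ↔ w (t + 1) i ∈ F) := by
    intro i hi
    rw [mono_C _ _ _ hi, w_succ ht8 hi]
    by_cases hic : i = t % 8
    · rw [if_pos hic, hic]
      rw [← hK]
      cases h1 : k.testBit (t % 8) <;> cases K <;> simp_all
    · rw [if_neg hic, ← hN.hC i hi]
      have : ¬ t % 8 = i := fun h => hic h.symm
      simp [this]
  have hlt := mono_lt (t % 8) k hc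
  have hcolor : ∀ y, (y ∈ F ↔ t - 8 ∈ F) ↔ ¬ (y ∈ F ↔ t ∈ F) := by
    intro y
    tauto
  by_cases hmono : ∀ i < 8, (w (t + 1) i ∈ F ↔ t ∈ F)
  · have hsink : ∀ C, (C = if (!K) then 0 else 255) → Sink F (t + 1) C (!K) := by
      intro C hC
      have hk : ∀ y, (y ∈ F ↔ (!K) = true) ↔ (y ∈ F ↔ t - 8 ∈ F) := by
        intro y
        rw [hcolor, ← hK]
        cases K <;> simp
      constructor
      · omega
      · exact ⟨t - 8, by omega, by omega, (hk _).2 Iff.rfl⟩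
      · have h1 : ∀ a, 8 ≤ a → a < t + 1 → (a ∈ F ↔ (!K) = true) → Conn F (t + 1) (t - 8) a := by
          intro a ha hat hcol
          rw [hk] at hcol
          have hat' : a ≠ t := by
            rintro rfl
            exact hD hcol.symm
          obtain ⟨i, hi, hia⟩ := hN.hcov a ha (by omega)
          by_cases hic : i = t % 8
          · rw [hic, w_c ht8] at hia
            exact hia.mono
          · exfalso
            have h2 := hmono i hi
            rw [w_succ ht8 hi, if_neg hic, hia.col] at h2
            exact (hcolor a).1 hcol h2
        intro a b ha hat hb hbt hca hcb
        exact (h1 a ha hat hca).symm.trans (h1 b hb hbt hcb)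
      · intro i hi
        rw [hk, hcolor, not_not]
        exact hmono i hi
      · intro a ha hat hcol
        rw [hk, hcolor, not_not] at hcol
        by_cases h : a = t
        · refine ⟨t % 8, hc, ?_⟩
          rw [w_succ ht8 hc, if_pos rfl, h]
          exact .refl
        · obtain ⟨i, hi, hia⟩ := hN.hcov a ha (by omega)
          by_cases hic : i = t % 8
          · exfalso
            rw [hic, w_c ht8] at hia
            exact (hcolor a).1 hia.col.symm hcol
          · refine ⟨i, hi, ?_⟩
            rw [w_succ ht8 hi, if_neg hic]
            exact hia.mono
      · exact hC
    have hval : (k &&& 255) ^^^ 2 ^ (t % 8) = if (!K) then 0 else 255 := by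
      cases K with
      | false =>
        have : t ∉ F := fun h => absurd (hK.2 h) (by decide)
        refine (eq_zero_iff _ hlt).2 fun i hi => ?_
        have h1 := hCb i hi
        have h2 := hmono i hi
        by_contra hh
        exact this (h2.1 (h1.1 (by simpa using hh)))
      | true =>
        have : t ∈ F := hK.1 rfl
        refine (eq_255_iff _ hlt).2 fun i hi => ?_
        exact (hCb i hi).2 ((hmono i hi).2 this)
    rw [if_pos (by rw [hval]; cases K <;> simp)]
    exact Or.inr ⟨_, hsink _ hval⟩
  · rw [if_neg]
    · push Not at hmono
      obtain ⟨j, hj, hjF⟩ := hmono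
      have hjc : j ≠ t % 8 := by
        rintro rfl
        rw [w_succ ht8 hc, if_pos rfl] at hjF
        tauto
      rw [w_succ ht8 hj, if_neg hjc] at hjF
      have h1 := w_lt ht8 hj
      refine ⟨t - 8, w t j, by omega, by omega, w_real ht j, by omega, ?_, hcl, fun h =>
        hal' j hj hjc (key _ h)⟩
      tauto
    · rintro (h | h)
      · refine hmono fun i hi => ?_
        have h0 := fun i hi => ((eq_zero_iff _ hlt).1 h) i hi
        have e1 := hCb i hi
        have e2 := hCb _ hc
        rw [h0 _ hi] at e1
        rw [h0 _ hc, w_succ ht8 hc, if_pos rfl] at e2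
        rw [← e1, ← e2]
      · refine hmono fun i hi => ?_
        have h0 := fun i hi => ((eq_255_iff _ hlt).1 h) i hi
        have e1 := hCb i hi
        have e2 := hCb _ hc
        rw [h0 _ hi] at e1
        rw [h0 _ hc, w_succ ht8 hc, if_pos rfl] at e2
        rw [← e1, ← e2]

theorem sink_k : ∀ c < 8, ∀ κ K : Bool, 
    stepS c K (if κ then 0 else 255) = if K = κ then none else some (if κ then 0 else 255) := by
  have h1 : ∀ c < 8, ∀ κ K : Bool, sm K c (if κ then 0 else 255) = if κ then 0 else 255 := by
    intro c hc κ K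
    interval_cases c <;> cases κ <;> cases K <;> rfl
  have h2 : ∀ c < 8, ∀ κ : Bool, (if κ then 0 else 255).testBit c = !κ := by decide
  have h3 : ∀ c < 8, ∀ κ : Bool, (if κ then 0 else 255) &&& rxc c = 0 := by decide +kernel
  have h4 : ∀ c < 8, ∀ κ : Bool, ((if κ then 0 else 255) &&& 255) ^^^ 2 ^ c ≠ 0 ∧ 
      ((if κ then 0 else 255) &&& 255) ^^^ 2 ^ c ≠ 255 := by decide +kernel
  intro c hc κ K
  rw [stepS, h2 c hc, h1 c hc, stepD, h3 c hc, if_neg (c := _ ∨ _)]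
  · cases κ <;> cases K <;> rfl
  · rintro (h | h)
    · exact (h4 c hc κ).1 h
    · exact (h4 c hc κ).2 h

theorem sink_step {k : ℕ} {K κ : Bool} (hK : K = true ↔ t ∈ F) (hN : Sink F t k κ) :
    Inv F (t + 1) (stepS (t % 8) K k) := by
  have ht := hN.ht
  have ht8 : 8 ≤ t := by omega
  have hc : t % 8 < 8 := Nat.mod_lt _ (by omega)
  rw [hN.s5, sink_k _ hc]
  by_cases h : K = κ
  · subst h
    rw [if_pos rfl]
    obtain ⟨a, ha, hat, hac⟩ := hN.s1
    have hP : ¬ P F t a := by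
      rintro (h | h | h)
      · omega
      · have := hN.s3 _ hc
        rw [w_c ht8, hK] at this
        exact this h.2.1
      · have := hN.s3 (t % 8 - 1) (by omega)
        rw [w_c1 ht8 h.1, hK] at this
        exact this h.2.1
    have key : ∀ x, Conn F (t + 1) a x → Conn F t a x := by
      intro x hx
      rcases (conn_succ ht8).1 hx with h | h
      · exact h
      · exact absurd h.1 hP
    refine ⟨a, t, ha, by omega, ht8, by omega, by rw [hac, hK], ?_, ?_⟩
    · intro x hx
      have h := key x hx
      by_contra hh
      have hxt : x < t := by
        rcases h.bd with h | h <;> omega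
      obtain ⟨i, hi, rfl⟩ := w_surj ht8 (by omega) hxt
      apply hN.s3 i hi
      rw [← h.col]
      exact hac
    · intro h
      exact not_conn_new (by omega) (key _ h)
  · rw [if_neg h]
    have hcol : ¬ (t ∈ F ↔ κ = true) := by
      rw [← hK, ← Bool.eq_iff_iff]
      exact h
    refine Or.inr ⟨κ, ?_⟩
    constructor
    · omega
    · obtain ⟨a, ha, hat, hac⟩ := hN.s1
      exact ⟨a, ha, by omega, hac⟩
    · intro a b ha hat hb hbt hca hcb
      have h1 : a ≠ t := by
        rintro rfl
        exact hcol hca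
      have h2 : b ≠ t := by
        rintro rfl
        exact hcol hcb
      exact (hN.s2 a b ha (by omega) hb (by omega) hca hcb).mono
    · intro i hi
      rw [w_succ ht8 hi]
      split_ifs
      · exact hcol
      · exact hN.s3 i hi
    · intro a ha hat hca
      by_cases h : a = t
      · refine ⟨t % 8, hc, ?_⟩
        rw [w_succ ht8 hc, if_pos rfl, h]
        exact .refl
      · obtain ⟨i, hi, hia⟩ := hN.s4 a ha (by omega) hca
        by_cases hic : i = t % 8
        · refine ⟨t % 8, hc, ?_⟩
          rw [w_succ ht8 hc, if_pos rfl]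
          rw [hic, w_c ht8] at hia
          refine P.conn ht8 (Or.inr (Or.inl ⟨ht, ?_, hia⟩))
          have := hia.col
          tauto
        · refine ⟨i, hi, ?_⟩
          rw [w_succ ht8 hi, if_neg hic]
          exact hia.mono
    · rfl

theorem inv_step (hF : ∀ x ∈ F, 8 ≤ x) (ht : 8 ≤ t) (o : Option ℕ) (h : Inv F t o) :
    Inv F (t + 1) (o.bind (step t (decide (t ∈ F)))) := by
  have hc : t % 8 < 8 := Nat.mod_lt _ (by omega)
  cases o with
  | none => exact Dead.succ ht h
  | some k =>
    rw [Option.bind_some]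
    have hK : decide (t ∈ F) = true ↔ t ∈ F := by simp
    generalize decide (t ∈ F) = K at hK
    rcases h with hN | ⟨κ, hN⟩
    · unfold step
      split_ifs with h16
      · have hwc : w t (t % 8) < 8 := by
          rw [w_c ht]
          omega
        have hBz : ∀ i < 8, ∀ j < 8, B k i j = true → i ≠ t % 8 ∧ j ≠ t % 8 := by
          intro i hi j hj h
          have := (hN.hB i hi j hj).1 h
          constructor
          · rintro rfl
            omega
          · rintro rfl
            omega
        have hkc : k.testBit (t % 8) = false := by
          by_contra hh
          have := hF _ ((hN.hC _ hc).1 (by simpa using hh))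
          omega
        left
        refine new_step ht hK hN (by omega) ?_ ?_ (Or.inl h16)
        · intro i hi j hj
          have e : B (if K = true then k ||| 2 ^ (t % 8) else k) i j = B k i j := by
            split_ifs
            · unfold B
              rw [Nat.testBit_or, Nat.testBit_two_pow]
              have : ¬ t % 8 = 8 + 8 * i + j := by omega
              simp [this]
            · rfl
          rw [e]
          exact ⟨fun h => ⟨h, hBz i hi j hj h⟩, fun h => h.1⟩
        · intro i hi
          rw [w_succ ht hi]
          by_cases hic : i = t % 8
          · rw [if_pos hic, hic, ← hK]
            split_ifs with h
            · simp [h]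
            · simp [h, hkc]
          · rw [if_neg hic, ← hN.hC i hi]
            have : ¬ t % 8 = i := fun h => hic h.symm
            split_ifs with h
            · rw [Nat.testBit_or, Nat.testBit_two_pow]
              simp [this]
            · rfl
      · unfold stepS
        split_ifs with hS
        · exact Or.inl (same_step (by omega) hK hN hS)
        · unfold stepD
          by_cases hal : k &&& rxc (t % 8) = 0
          · rw [if_pos hal]
            exact alone_step (by omega) hK hN hS ((alone_iff _ _ hc).1 hal)
          · rw [if_neg hal]
            left
            refine new_step ht hK hN ?_ ?_ ?_ (Or.inr ?_)
            · rintro ⟨_, h⟩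
              apply hS
              rw [Bool.eq_iff_iff, hK, hN.hC _ hc, w_c ht, h]
            · intro i hi j hj
              rw [diff_B _ _ _ _ hc hi hj]
              simp
            · intro i hi
              rw [diff_C _ _ _ hc hi, w_succ ht hi]
              by_cases hic : i = t % 8
              · rw [if_pos hic, hic, ← hK]
                cases h1 : k.testBit (t % 8) <;> cases K <;> simp_all
              · rw [if_neg hic, ← hN.hC i hi]
                have : ¬ t % 8 = i := fun h => hic h.symm
                simp [this]
            · rw [alone_iff _ _ hc] at hal
              push Not at hal
              obtain ⟨j, hj, hjc, h⟩ := hal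
              exact ⟨j, hj, hjc, by simpa using h⟩
    · have := hN.ht
      rw [step, if_neg (by omega)]
      exact sink_step hK hN

theorem inv_all (hF : ∀ x ∈ F, 8 ≤ x) (ht : 8 ≤ t) : Inv F t (st F t) := by
  induction t, ht using Nat.le_induction with
  | base =>
    rw [st_eight]
    exact Or.inl (normal_zero hF)
  | succ t ht ih =>
    rw [st_succ F ht]
    exact inv_step hF ht _ ih

/-- One colour class is nonempty and connected. -/
def Good1 (F : Finset ℕ) (q : ℕ → Prop) : Prop :=
  (∃ a, 8 ≤ a ∧ a < 72 ∧ q a) ∧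
    ∀ a b, 8 ≤ a → a < 72 → 8 ≤ b → b < 72 → q a → q b → Conn F 72 a b

/-- Both colour classes are nonempty and connected. -/
def Good (F : Finset ℕ) : Prop := Good1 F (· ∈ F) ∧ Good1 F (· ∉ F)

theorem row_testBit (k i j : ℕ) : (row k i).testBit j = (B k i j && decide (j < 8)) := by
  have : row k i = (k >>> (8 + 8 * i)) &&& 255 := rfl
  rw [this, Nat.testBit_and, tb_255, Nat.testBit_shiftRight]
  rfl

theorem row_lem {k : ℕ} (hN : Normal F 72 k) (q : ℕ → Prop)
    (hq : ∀ a b, Conn F 72 a b → (q a ↔ q b)) (C : ℕ) (hC : C < 2 ^ 8) 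
    (hCq : ∀ i < 8, (C.testBit i = true ↔ q (w 72 i))) :
    row k (Nat.log2 C) = C ↔ Good1 F q := by
  have hreal : ∀ i, 8 ≤ w 72 i := fun i => w_real (by omega) i
  have hlt : ∀ i < 8, w 72 i < 72 := fun i hi => w_lt (by omega) hi
  have hB : ∀ i < 8, ∀ j < 8, (B k i j = true ↔ Conn F 72 (w 72 i) (w 72 j)) := by
    intro i hi j hj
    rw [hN.hB i hi j hj]
    exact ⟨fun h => h.2.2, fun h => ⟨hreal i, hreal j, h⟩⟩
  have hlog : C ≠ 0 → Nat.log2 C < 8 ∧ C.testBit (Nat.log2 C) = true := by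
    intro h0
    exact ⟨(Nat.log2_lt h0).2 hC, Nat.testBit_log2 h0⟩
  constructor
  · intro h
    have h0 : C ≠ 0 := by
      rintro rfl
      have h1 := row_testBit k (Nat.log2 0) 0
      rw [h] at h1
      have h2 : B k 0 0 = true := (hB 0 (by omega) 0 (by omega)).2 .refl
      simp [h2] at h1
    obtain ⟨h8, hb⟩ := hlog h0
    have hall : ∀ x, 8 ≤ x → x < 72 → q x → Conn F 72 (w 72 (Nat.log2 C)) x := by
      intro x hx hx' hqx
      obtain ⟨i, hi, hix⟩ := hN.hcov x hx hx'
      have h1 := (hCq i hi).2 ((hq _ _ hix).2 hqx)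
      have h2 := row_testBit k (Nat.log2 C) i
      rw [h, h1] at h2
      have h3 : B k (Nat.log2 C) i = true := by
        simp at h2
        exact h2.1
      exact ((hB _ h8 _ hi).1 h3).trans hix
    exact ⟨⟨w 72 (Nat.log2 C), hreal _, hlt _ h8, (hCq _ h8).1 hb⟩, fun a b ha ha' hb hb' hqa hqb =>
      (hall a ha ha' hqa).symm.trans (hall b hb hb' hqb)⟩
  · rintro ⟨⟨x, hx, hx', hqx⟩, hall⟩
    have h0 : C ≠ 0 := by
      rintro rfl
      obtain ⟨i, hi, hix⟩ := hN.hcov x hx hx'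
      have h1 := (hCq i hi).2 ((hq _ _ hix).2 hqx)
      simp at h1
    obtain ⟨h8, hb⟩ := hlog h0
    apply Nat.eq_of_testBit_eq
    intro j
    rw [row_testBit]
    by_cases hj : j < 8
    · simp only [hj, decide_true, Bool.and_true]
      rw [Bool.eq_iff_iff, hB _ h8 _ hj, hCq j hj]
      have hqa := (hCq _ h8).1 hb
      exact ⟨fun h => (hq _ _ h).1 hqa, fun h => hall _ _ (hreal _) (hlt _ h8) (hreal _) (hlt _ hj)
        hqa h⟩
    · rw [Nat.testBit_lt_two_pow (hC.trans_le (Nat.pow_le_pow_right (by omega) (by omega)))]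
      simp [hj]

theorem compl_bits : ∀ C < 256, ∀ i < 8, (255 - C).testBit i = !C.testBit i := by decide +kernel

theorem normal_acc {k : ℕ} (hN : Normal F 72 k) : accB k = true ↔ Good F := by
  have h00 : B k 0 0 = true := by
    rw [hN.hB 0 (by omega) 0 (by omega)]
    exact ⟨w_real (by omega) _, w_real (by omega) _, .refl⟩
  have hne : k >>> 8 ≠ 0 := by
    intro h
    have := congrArg (fun x => x.testBit 0) h
    simp only [Nat.testBit_shiftRight, Nat.zero_testBit] at this
    have h2 : B k 0 0 = k.testBit (8 + 0) := rfl
    rw [h2, this] at h00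
    exact absurd h00 (by decide)
  have hlt : k &&& 255 < 2 ^ 8 := Nat.and_lt_two_pow _ (by norm_num)
  have hC : ∀ i < 8, ((k &&& 255).testBit i = true ↔ w 72 i ∈ F) := by
    intro i hi
    rw [Nat.testBit_and, tb_255, ← hN.hC i hi]
    simp [hi]
  have hC' : ∀ i < 8, ((255 - (k &&& 255)).testBit i = true ↔ w 72 i ∉ F) := by
    intro i hi
    rw [compl_bits _ hlt i hi, ← hC i hi]
    cases (k &&& 255).testBit i <;> decide
  have r1 := row_lem hN (· ∈ F) (fun a b h => h.col) _ hlt hC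
  have r2 := row_lem hN (· ∉ F) (fun a b h => not_congr h.col) _ (by omega) hC'
  unfold Good
  rw [← r1, ← r2]
  have e : accB k = ((k >>> 8).beq 0 || ((row k (Nat.log2 (k &&& 255))).beq (k &&& 255) && 
    (row k (Nat.log2 (255 - (k &&& 255)))).beq (255 - (k &&& 255)))) := rfl
  rw [e]
  simp [hne]

theorem sink_acc {k : ℕ} {κ : Bool} (hN : Sink F 72 k κ) : Good F := by
  have hw : ∀ i < 8, w 72 i = 64 + i := by
    intro i hi
    unfold w
    split_ifs <;> omega
  have hrow : ∀ i < 8, Conn F 72 64 (64 + i) := by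
    intro i
    induction i with
    | zero => exact fun _ => .refl
    | succ i ih =>
      intro hi
      refine Relation.ReflTransGen.tail (ih (by omega)) ⟨by omega, by omega, ⟨by omega, by omega,
        Or.inr (Or.inr (Or.inl ⟨by omega, by omega⟩))⟩, ?_⟩
      have h1 := hN.s3 i (by omega)
      have h2 := hN.s3 (i + 1) hi
      rw [hw _ (by omega)] at h1 h2
      tauto
  have g1 : Good1 F (fun x => (x ∈ F ↔ κ = true)) := ⟨hN.s1, hN.s2⟩
  have h4 : ∀ a, 8 ≤ a → a < 72 → ¬ (a ∈ F ↔ κ = true) → Conn F 72 64 a := by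
    intro a ha ha' hc
    obtain ⟨i, hi, hia⟩ := hN.s4 a ha ha' hc
    rw [hw i hi] at hia
    exact (hrow i hi).trans hia
  have g2 : Good1 F (fun x => ¬ (x ∈ F ↔ κ = true)) := by
    refine ⟨⟨64, by omega, by omega, ?_⟩, fun a b ha ha' hb hb' hqa hqb =>
      (h4 a ha ha' hqa).symm.trans (h4 b hb hb' hqb)⟩
    have := hN.s3 0 (by omega)
    rw [hw 0 (by omega)] at this
    exact this
  unfold Good
  cases κ
  · simp only [Bool.false_eq_true, iff_false, not_not] at g1 g2
    exact ⟨g2, g1⟩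
  · simp only [iff_true] at g1 g2
    exact ⟨g1, g2⟩

theorem dead_not_good (h : Dead F 72) : ¬ Good F := by
  obtain ⟨a, b, h1, h2, h3, h4, h5, h6, h7⟩ := h
  rintro ⟨g1, g2⟩
  apply h7
  by_cases ha : a ∈ F
  · exact g1.2 a b h1 h2 h3 h4 ha (h5.1 ha)
  · exact g2.2 a b h1 h2 h3 h4 ha (fun hb => ha (h5.2 hb))

open Classical in
theorem opt_good (hF : ∀ x ∈ F, 8 ≤ x) :
    opt (fun k => if accB k then 1 else 0) (st F 72) = if Good F then 1 else 0 := by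
  have h := inv_all (t := 72) hF (by omega)
  cases hs : st F 72 with
  | none =>
    rw [hs] at h
    rw [if_neg (dead_not_good h)]
    rfl
  | some k =>
    rw [hs] at h
    rcases h with h | ⟨κ, h⟩
    · have := normal_acc h
      simp [opt, this]
    · rw [if_pos (sink_acc h), h.s5]
      cases κ <;> decide

end GM

namespace GM

/-! ### From finsets of cells to colourings -/

/-- Index of a cell. -/
def phi (x : Fin 8 × Fin 8) : ℕ := 8 + 8 * (x.1 : ℕ) + (x.2 : ℕ)

theorem phi_inj : Function.Injective phi := by
  rintro ⟨a, b⟩ ⟨c, d⟩ h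
  simp only [phi] at h
  have h1 := a.2
  have h2 := b.2
  have h3 := c.2
  have h4 := d.2
  ext <;> simp only <;> omega

theorem phi_bd (x : Fin 8 × Fin 8) : 8 ≤ phi x ∧ phi x < 72 := by
  have h1 := x.1.2
  have h2 := x.2.2
  unfold phi
  omega

theorem phi_surj {a : ℕ} (h : 8 ≤ a) (h' : a < 72) : ∃ x, phi x = a :=
  ⟨(⟨(a - 8) / 8, by omega⟩, ⟨a % 8, by omega⟩), by simp only [phi]; omega⟩

theorem grid_adj (x y : Fin 8 × Fin 8) : (gridGraph 8 8).Adj x y ↔ adj (phi x) (phi y) := by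
  obtain ⟨a, b⟩ := x
  obtain ⟨c, d⟩ := y
  have h1 := a.2
  have h2 := b.2
  have h3 := c.2
  have h4 := d.2
  unfold gridGraph adj phi
  simp only [SimpleGraph.fromRel_adj, ne_eq, Prod.mk.injEq, Fin.ext_iff]
  omega

theorem region_iff (F : Finset ℕ) (U : Finset (Fin 8 × Fin 8)) (q : ℕ → Prop)
    (hU : ∀ x, x ∈ U ↔ q (phi x)) (hq1 : ∀ a b, q a → q b → (a ∈ F ↔ b ∈ F))
    (hq2 : ∀ a b, q a → (a ∈ F ↔ b ∈ F) → q b) : ConnectedRegion 8 8 U ↔ Good1 F q := by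
  unfold ConnectedRegion
  rw [SimpleGraph.connected_iff]
  constructor
  · rintro ⟨hpre, ⟨⟨u, hu⟩⟩⟩
    refine ⟨⟨phi u, (phi_bd u).1, (phi_bd u).2, (hU u).1 (by simpa using hu)⟩, ?_⟩
    intro a b ha ha' hb hb' hqa hqb
    obtain ⟨x, rfl⟩ := phi_surj ha ha'
    obtain ⟨y, rfl⟩ := phi_surj hb hb'
    have h := hpre ⟨x, by simpa using (hU x).2 hqa⟩ ⟨y, by simpa using (hU y).2 hqb⟩
    rw [SimpleGraph.reachable_iff_reflTransGen] at h
    refine Relation.ReflTransGen.lift (r := ((gridGraph 8 8).induce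
      (U : Set (Fin 8 × Fin 8))).Adj) (p := R F 72) (fun u => phi u.1) ?_ _ _ h
    rintro ⟨u, hu⟩ ⟨v, hv⟩ huv
    simp only [SimpleGraph.comap_adj, Function.Embedding.subtype_apply, grid_adj] at huv
    exact ⟨(phi_bd u).2, (phi_bd v).2, huv, hq1 _ _ ((hU u).1 (by simpa using hu))
      ((hU v).1 (by simpa using hv))⟩
  · rintro ⟨⟨a, ha, ha', hqa⟩, hall⟩
    have key : ∀ a b, Conn F 72 a b → ∀ x (hx : x ∈ (U : Set (Fin 8 × Fin 8))), phi x = a →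
        ∃ y, ∃ hy : y ∈ (U : Set (Fin 8 × Fin 8)), phi y = b ∧
        ((gridGraph 8 8).induce (U : Set (Fin 8 × Fin 8))).Reachable ⟨x, hx⟩ ⟨y, hy⟩ := by
      intro a b h x hx hxa
      induction h with
      | refl => exact ⟨x, hx, hxa, SimpleGraph.Reachable.refl _⟩
      | tail h1 h2 ih =>
        obtain ⟨y, hy, hyb, hr⟩ := ih
        obtain ⟨hb, hc, hE, hcol⟩ := h2
        obtain ⟨z, hz⟩ := phi_surj hE.2.1 hc
        subst hyb
        subst hz
        have hqz := hq2 _ _ ((hU y).1 (by simpa using hy)) hcol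
        refine ⟨z, by simpa using (hU z).2 hqz, rfl, hr.trans (SimpleGraph.Adj.reachable ?_)⟩
        simp only [SimpleGraph.comap_adj, Function.Embedding.subtype_apply, grid_adj]
        exact hE
    refine ⟨?_, ?_⟩
    · rintro ⟨x, hx⟩ ⟨y, hy⟩
      have h := hall _ _ (phi_bd x).1 (phi_bd x).2 (phi_bd y).1 (phi_bd y).2
        ((hU x).1 (by simpa using hx)) ((hU y).1 (by simpa using hy))
      obtain ⟨z, hz, e, hr⟩ := key _ _ h x hx rfl
      have := phi_inj e
      subst this
      exact hr
    · obtain ⟨x, rfl⟩ := phi_surj ha ha'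
      exact ⟨⟨x, by simpa using (hU x).2 hqa⟩⟩

/-- The colouring associated with a set of cells. -/
def img (S : Finset (Fin 8 × Fin 8)) : Finset ℕ := S.map ⟨phi, phi_inj⟩

theorem mem_img (S : Finset (Fin 8 × Fin 8)) (x : Fin 8 × Fin 8) : phi x ∈ img S ↔ x ∈ S := by
  unfold img
  exact Finset.mem_map' ⟨phi, phi_inj⟩

theorem img_good (S : Finset (Fin 8 × Fin 8)) :
    (ConnectedRegion 8 8 S ∧ ConnectedRegion 8 8 Sᶜ) ↔ Good (img S) := by
  rw [region_iff (img S) S (· ∈ img S) (fun x => (mem_img S x).symm) (by tauto) (by tauto),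
    region_iff (img S) Sᶜ (· ∉ img S) (fun x => by rw [mem_img, Finset.mem_compl]) (by tauto)
    (by tauto)]
  rfl

open Classical in
/-- Number of good colourings with `j` cells of the first colour. -/
noncomputable def cnt (j : ℕ) : ℕ :=
  (((Finset.Ico 8 72).powerset).filter fun F => F.card = j ∧ Good F).card

theorem card_eq_cnt : Nat.card {S : Finset (Fin 8 × Fin 8) //
      S.card = 32 ∧ ConnectedRegion 8 8 S ∧ ConnectedRegion 8 8 Sᶜ} = cnt 32 := by
  classical
  unfold cnt
  rw [Nat.card_eq_fintype_card, Fintype.card_subtype]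
  refine Finset.card_bij (fun S _ => img S) ?_ ?_ ?_
  · intro S hS
    rw [Finset.mem_filter] at hS ⊢
    refine ⟨Finset.mem_powerset.2 ?_, ?_, (img_good S).1 hS.2.2⟩
    · intro a ha
      obtain ⟨x, _, rfl⟩ := Finset.mem_map.1 ha
      exact Finset.mem_Ico.2 (phi_bd x)
    · rw [img, Finset.card_map]
      exact hS.2.1
  · intro S _ S' _ h
    exact Finset.map_injective _ h
  · intro F hF
    rw [Finset.mem_filter, Finset.mem_powerset] at hF
    have e : img (Finset.univ.filter fun x => phi x ∈ F) = F := by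
      ext a
      constructor
      · intro ha
        obtain ⟨x, hx, rfl⟩ := Finset.mem_map.1 ha
        exact (Finset.mem_filter.1 hx).2
      · intro ha
        have h1 := Finset.mem_Ico.1 (hF.1 ha)
        obtain ⟨x, rfl⟩ := phi_surj h1.1 h1.2
        rw [mem_img]
        simpa using ha
    refine ⟨Finset.univ.filter fun x => phi x ∈ F, ?_, e⟩
    rw [Finset.mem_filter]
    refine ⟨Finset.mem_univ _, ?_, (img_good _).2 (by rw [e]; exact hF.2.2)⟩
    have h2 := hF.2.1
    rw [← e, img, Finset.card_map] at h2
    exact h2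

theorem cnt_lt (j : ℕ) : cnt j < X := by
  classical
  unfold cnt
  refine (Finset.card_filter_le _ _).trans_lt ?_
  rw [Finset.card_powerset, Nat.card_Ico]
  unfold X
  norm_num

theorem total_eq : total = ∑ j ∈ Finset.range 65, X ^ j * cnt j := by
  classical
  unfold total cnt
  rw [← Finset.sum_fiberwise_of_maps_to (s := (Finset.Ico 8 72).powerset) (t := Finset.range 65)
    (g := Finset.card)]
  · refine Finset.sum_congr rfl fun j hj => ?_
    rw [Finset.card_filter, Finset.mul_sum, Finset.sum_filter]
    refine Finset.sum_congr rfl fun F hF => ?_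
    rw [opt_good (fun x hx => (Finset.mem_Ico.1 (Finset.mem_powerset.1 hF hx)).1)]
    by_cases h : F.card = j
    · simp [h]
    · simp [h]
  · intro F hF
    have := Finset.card_le_card (Finset.mem_powerset.1 hF)
    rw [Nat.card_Ico] at this
    rw [Finset.mem_range]
    omega

theorem digits_lt (Y : ℕ) (f : ℕ → ℕ) (hf : ∀ j, f j < Y) (n : ℕ) :
    ∑ j ∈ Finset.range n, Y ^ j * f j < Y ^ n := by
  induction n with
  | zero => simp
  | succ n ih =>
    rw [Finset.sum_range_succ, pow_succ]
    have h1 : f n + 1 ≤ Y := hf n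
    have h2 : Y ^ n * (f n + 1) ≤ Y ^ n * Y := Nat.mul_le_mul_left _ h1
    rw [Nat.mul_add, Nat.mul_one] at h2
    omega

theorem digit (Y : ℕ) (f : ℕ → ℕ) (hf : ∀ j, f j < Y) (m r : ℕ) :
    (∑ j ∈ Finset.range (m + (r + 1)), Y ^ j * f j) / Y ^ m % Y = f m := by
  have hY : 0 < Y := (Nat.zero_le _).trans_lt (hf 0)
  rw [Finset.sum_range_add, Finset.sum_range_succ']
  have e : ∑ k ∈ Finset.range r, Y ^ (m + (k + 1)) * f (m + (k + 1)) + Y ^ (m + 0) * f (m + 0) =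
      Y ^ m * (Y * (∑ k ∈ Finset.range r, Y ^ k * f (m + (k + 1))) + f m) := by
    rw [Nat.mul_add, Finset.mul_sum, Finset.mul_sum]
    congr 1
    refine Finset.sum_congr rfl fun k _ => ?_
    ring
  rw [e, Nat.add_mul_div_left _ _ (Nat.pow_pos hY), Nat.div_eq_of_lt (digits_lt Y f hf m), zero_add,
    Nat.mul_add_mod, Nat.mod_eq_of_lt (hf m)]

theorem digit_of_lt (Y : ℕ) (f : ℕ → ℕ) (hf : ∀ j, f j < Y) (n m : ℕ) (h : m < n) :
    (∑ j ∈ Finset.range n, Y ^ j * f j) / Y ^ m % Y = f m := by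
  obtain ⟨r, rfl⟩ := Nat.exists_eq_add_of_lt h
  exact digit Y f hf m r

theorem cnt_aux (m v s : ℕ) (hm : m < 65) (hs : s = ∑ j ∈ Finset.range 65, X ^ j * cnt j)
    (h : s / X ^ m % X = v) : cnt m = v := by
  rw [hs, digit_of_lt X cnt cnt_lt 65 m hm] at h
  exact h

theorem cnt_32 : cnt 32 = 14314228378 :=
  cnt_aux 32 14314228378 total (by norm_num) total_eq total_spec

end GM

theorem gerrymander_count_8x8 :
    Nat.card {S : Finset (Fin 8 × Fin 8) //
      S.card = 32 ∧ ConnectedRegion 8 8 S ∧ ConnectedRegion 8 8 Sᶜ} = 14314228378 :=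
  GM.card_eq_cnt.trans GM.cnt_32
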